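/- arXiv:0711.2867 — 3 statements merged into one kernel-verified Lean document; each statement's English description precedes it below -/
import Mathlib

section
/- Optimal internal link structure: assume I and Ī are nonempty and fix E_out(I), E_in(I), E_Ī. Let L = {i ∈ I : (i,j) ∈ E_out(I) for some j ∈ Ī} be the set of leaking nodes, n_L = |L| and n_I = |I|. Let H be an optimal internal link set and let v be computed in the graph H ∪ E_out(I) ∪ E_in(I) ∪ E_Ī. Then there is a relabeling of the nodes of I as {1, 2, …, n_I} under which L = {n_I − n_L + 1, …, n_I}, v_1 > v_2 > … > v_{n_I − n_L} > v_{n_I − n_L + 1} ≥ … ≥ v_{n_I}, and E_I^L ⊆ H ⊆ E_I^U, where E_I^L = {(i,j) ∈ I×I : j ≤ i} ∪ {(i, i+1) : i ∈ I ∖ L} and E_I^U = E_I^L ∪ {(i,j) ∈ L×L : i < j}. -/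
open Matrix Finset

/-- Outdegree of node `i` in the edge set `E`. -/
def outdeg {n : ℕ} (E : Finset (Fin n × Fin n)) (i : Fin n) : ℕ :=
  (Finset.univ.filter (fun j => (i, j) ∈ E)).card

/-- The scaled adjacency matrix `P` of the graph: `P i j = 1 / outdeg i` if `(i,j) ∈ E`. -/
noncomputable def Pmat {n : ℕ} (E : Finset (Fin n × Fin n)) : Matrix (Fin n) (Fin n) ℝ :=
  fun i j => if (i, j) ∈ E then ((outdeg E i : ℝ))⁻¹ else 0

/-- Indicator vector of a set of nodes. -/
def ind {n : ℕ} (I : Finset (Fin n)) : Fin n → ℝ :=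
  fun i => if i ∈ I then 1 else 0

/-- `v = (Id - cP)⁻¹ e_I`, the vector of mean numbers of visits to `I` before zapping. -/
noncomputable def vvec {n : ℕ} (c : ℝ) (E : Finset (Fin n × Fin n)) (I : Finset (Fin n)) : Fin n → ℝ :=
  (1 - c • Pmat E)⁻¹ *ᵥ ind I

/-- PageRank vector `πᵀ = (1-c) zᵀ (Id - cP)⁻¹`. -/
noncomputable def pr {n : ℕ} (c : ℝ) (z : Fin n → ℝ) (E : Finset (Fin n × Fin n)) : Fin n → ℝ :=
  (1 - c) • (((1 - c • Pmat E)⁻¹)ᵀ *ᵥ z)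

/-- PageRank of the set `I`: `πᵀ e_I`. -/
noncomputable def prSet {n : ℕ} (c : ℝ) (z : Fin n → ℝ) (E : Finset (Fin n × Fin n))
    (I : Finset (Fin n)) : ℝ :=
  ∑ i ∈ I, pr c z E i

/-- Node `i` has access to (some node of) the set `J`: `i ∈ J` or a directed path from `i`
reaches `J`. -/
def access {n : ℕ} (E : Finset (Fin n × Fin n)) (i : Fin n) (J : Finset (Fin n)) : Prop :=
  ∃ j ∈ J, Relation.ReflTransGen (fun a b => (a, b) ∈ E) i j

/-- A graph is admissible for `I` (Assumption A + well-definedness): every node has at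
least one outlink and every node of `I` has access to the complement of `I`. -/
def admissible {n : ℕ} (E : Finset (Fin n × Fin n)) (I : Finset (Fin n)) : Prop :=
  (∀ i, 0 < outdeg E i) ∧ ∀ i ∈ I, access E i Iᶜ


lemma rtg_mono {α : Type*} {r s : α → α → Prop} {x y : α} (h : Relation.ReflTransGen r x y)
    (hrs : ∀ a b, r a b → s a b) : Relation.ReflTransGen s x y := by
  induction h with
  | refl => exact Relation.ReflTransGen.refl
  | tail _ hab ih => exact ih.tail (hrs _ _ hab)

/-- Out-neighbours. -/
def nb {n : ℕ} (E : Finset (Fin n × Fin n)) (i : Fin n) : Finset (Fin n) :=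
  Finset.univ.filter (fun j => (i, j) ∈ E)

lemma mem_nb {n : ℕ} (E : Finset (Fin n × Fin n)) (i j : Fin n) : j ∈ nb E i ↔ (i, j) ∈ E := by
  simp [nb]

lemma Pmat_mulVec {n : ℕ} (E : Finset (Fin n × Fin n)) (u : Fin n → ℝ) (i : Fin n) :
    (Pmat E *ᵥ u) i = (outdeg E i : ℝ)⁻¹ * ∑ j ∈ nb E i, u j := by
  simp only [Matrix.mulVec, dotProduct, Pmat, nb, Finset.sum_filter, Finset.mul_sum]
  refine Finset.sum_congr rfl fun j _ => ?_
  split_ifs <;> simp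

lemma max_principle {n : ℕ} {c : ℝ} (hc0 : 0 < c) (hc1 : c < 1) (E : Finset (Fin n × Fin n))
    (hd : ∀ i, 0 < outdeg E i) (u : Fin n → ℝ)
    (hu : ∀ r, c * ∑ j ∈ nb E r, u j ≤ outdeg E r * u r) (r : Fin n) : 0 ≤ u r := by
  obtain ⟨m, -, hm⟩ := Finset.exists_min_image Finset.univ u ⟨r, Finset.mem_univ r⟩
  have h1 : (outdeg E m : ℝ) * u m ≤ ∑ j ∈ nb E m, u j := by
    have := Finset.card_nsmul_le_sum (nb E m) u (u m) (fun x _ => hm x (Finset.mem_univ x))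
    simpa [nb, outdeg] using this
  have h2 := hu m
  have h3 : (0 : ℝ) < outdeg E m := by exact_mod_cast hd m
  have h4 : 0 ≤ u m := by
    have : c * (outdeg E m * u m) ≤ outdeg E m * u m :=
      le_trans (mul_le_mul_of_nonneg_left h1 hc0.le) h2
    have h5 : 0 ≤ ((1 - c) * outdeg E m) * u m := by nlinarith
    exact nonneg_of_mul_nonneg_right h5 (mul_pos (by linarith) h3)
  exact h4.trans (hm r (Finset.mem_univ r))

lemma det_ne {n : ℕ} {c : ℝ} (hc0 : 0 < c) (hc1 : c < 1) (E : Finset (Fin n × Fin n))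
    (hd : ∀ i, 0 < outdeg E i) : (1 - c • Pmat E).det ≠ 0 := by
  intro h0
  obtain ⟨u, hne, hu⟩ := Matrix.exists_mulVec_eq_zero_iff.mpr h0
  have key : ∀ r, c * ∑ j ∈ nb E r, u j = outdeg E r * u r := by
    intro r
    have h1 := congrFun hu r
    have h3 : (0 : ℝ) < outdeg E r := by exact_mod_cast hd r
    rw [Matrix.sub_mulVec, Matrix.one_mulVec, Matrix.smul_mulVec] at h1
    simp only [Pi.sub_apply, Pi.smul_apply, Pmat_mulVec, smul_eq_mul, Pi.zero_apply] at h1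
    have : u r = c * ((outdeg E r : ℝ)⁻¹ * ∑ j ∈ nb E r, u j) := by linarith
    rw [this]; field_simp
  apply hne
  funext r
  have a := max_principle hc0 hc1 E hd u (fun r => (key r).le) r
  have b := max_principle hc0 hc1 E hd (fun r => - u r) (fun r => by
    rw [Finset.sum_neg_distrib]; have := key r; linarith) r
  simp only [Pi.zero_apply]; linarith

lemma vvec_eq {n : ℕ} {c : ℝ} (hc0 : 0 < c) (hc1 : c < 1) (E : Finset (Fin n × Fin n))
    (hd : ∀ i, 0 < outdeg E i) (I : Finset (Fin n)) (r : Fin n) :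
    outdeg E r * vvec c E I r = outdeg E r * ind I r + c * ∑ j ∈ nb E r, vvec c E I j := by
  have h : (1 - c • Pmat E) *ᵥ vvec c E I = ind I := by
    rw [vvec, Matrix.mulVec_mulVec, Matrix.mul_nonsing_inv _ (det_ne hc0 hc1 E hd).isUnit,
      Matrix.one_mulVec]
  have h1 := congrFun h r
  have h3 : (0 : ℝ) < outdeg E r := by exact_mod_cast hd r
  rw [Matrix.sub_mulVec, Matrix.one_mulVec, Matrix.smul_mulVec] at h1
  simp only [Pi.sub_apply, Pi.smul_apply, Pmat_mulVec, smul_eq_mul] at h1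
  rw [← h1]; field_simp; ring

lemma prSet_eq {n : ℕ} (c : ℝ) (z : Fin n → ℝ) (E : Finset (Fin n × Fin n))
    (I : Finset (Fin n)) : prSet c z E I = (1 - c) * ∑ i, z i * vvec c E I i := by
  have : prSet c z E I = ∑ i, ind I i * pr c z E i := by
    simp [prSet, ind, Finset.sum_ite_mem]
  rw [this]
  simp only [pr, vvec, Pi.smul_apply, smul_eq_mul, Matrix.mulVec, dotProduct, Matrix.transpose_apply,
    Finset.mul_sum]
  rw [Finset.sum_comm]
  refine Finset.sum_congr rfl fun i _ => Finset.sum_congr rfl fun j _ => by ring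

/-- One-row improvement. -/
lemma improve {n : ℕ} {c : ℝ} (hc0 : 0 < c) (hc1 : c < 1) (z : Fin n → ℝ) (hz : ∀ i, 0 < z i)
    (E E' : Finset (Fin n × Fin n)) (I : Finset (Fin n))
    (hd : ∀ i, 0 < outdeg E i) (hd' : ∀ i, 0 < outdeg E' i)
    (i : Fin n) (hi : i ∈ I) (hrow : ∀ a b, a ≠ i → ((a, b) ∈ E' ↔ (a, b) ∈ E))
    (hle : prSet c z E' I ≤ prSet c z E I) :
    ∑ j ∈ nb E' i, (vvec c E I j - (vvec c E I i - 1) / c) ≤ 0 := by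
  by_contra hpos
  push Not at hpos
  set v := vvec c E I with hv
  set v' := vvec c E' I with hv'
  have hsum : (outdeg E' i : ℝ) * ((v i - 1) / c) < ∑ j ∈ nb E' i, v j := by
    rw [Finset.sum_sub_distrib, Finset.sum_const, nsmul_eq_mul] at hpos
    have : outdeg E' i = (nb E' i).card := rfl
    rw [this]; linarith
  have hsum2 : (outdeg E' i : ℝ) * (v i - 1) < c * ∑ j ∈ nb E' i, v j := by
    have := mul_lt_mul_of_pos_left hsum hc0
    have e : c * ((outdeg E' i : ℝ) * ((v i - 1) / c)) = (outdeg E' i : ℝ) * (v i - 1) := by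
      field_simp
    linarith
  have hnb : ∀ a, a ≠ i → nb E' a = nb E a := by
    intro a ha; ext b; simp only [mem_nb]; exact hrow a b ha
  have hod : ∀ a, a ≠ i → outdeg E' a = outdeg E a := by
    intro a ha
    change (nb E' a).card = (nb E a).card
    rw [hnb a ha]
  have hI1 : ind I i = 1 := by simp [ind, hi]
  have hw : ∀ r, c * ∑ j ∈ nb E' r, (v' j - v j) ≤ outdeg E' r * (v' r - v r) ∧
      (r = i → c * ∑ j ∈ nb E' r, (v' j - v j) < outdeg E' r * (v' r - v r)) := by
    intro r
    have e1 := vvec_eq hc0 hc1 E hd I r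
    have e2 := vvec_eq hc0 hc1 E' hd' I r
    rw [← hv] at e1
    rw [← hv'] at e2
    rw [Finset.sum_sub_distrib, mul_sub, mul_sub]
    by_cases h : r = i
    · subst h
      rw [hI1] at e2
      constructor
      · nlinarith
      · intro _; nlinarith
    · rw [← hnb r h, ← hod r h] at e1
      exact ⟨by linarith, fun hh => absurd hh h⟩
  have hnn := max_principle hc0 hc1 E' hd' (fun r => v' r - v r) (fun r => (hw r).1)
  have hpi : 0 < v' i - v i := by
    have h1 := (hw i).2 rfl
    have h2 : 0 ≤ c * ∑ j ∈ nb E' i, (v' j - v j) :=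
      mul_nonneg hc0.le (Finset.sum_nonneg fun j _ => hnn j)
    have h3 : (0 : ℝ) < outdeg E' i := by exact_mod_cast hd' i
    exact pos_of_mul_pos_right (lt_of_le_of_lt h2 h1) h3.le
  rw [prSet_eq, prSet_eq, ← hv, ← hv'] at hle
  have h4 := le_of_mul_le_mul_left hle (by linarith)
  have h5 : ∑ j, z j * v j < ∑ j, z j * v' j :=
    Finset.sum_lt_sum (fun j _ => mul_le_mul_of_nonneg_left (by linarith [hnn j]) (hz j).le)
      ⟨i, Finset.mem_univ i, mul_lt_mul_of_pos_left (by linarith) (hz i)⟩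
  linarith

lemma v_gt_avg {n : ℕ} {c : ℝ} (hc0 : 0 < c) (hc1 : c < 1)
    (E : Finset (Fin n × Fin n)) (I : Finset (Fin n)) (hA : admissible E I)
    (i : Fin n) (hi : i ∈ I) : (vvec c E I i - 1) / c < vvec c E I i := by
  obtain ⟨hd, hacc⟩ := hA
  set v := vvec c E I with hv
  have hcc : 0 < 1 - c := by linarith
  have hb : ∀ r, outdeg E r * (1 / (1 - c) - v r) =
      outdeg E r * (1 - ind I r) + c * ∑ j ∈ nb E r, (1 / (1 - c) - v j) := by
    intro r
    have e1 := vvec_eq hc0 hc1 E hd I r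
    rw [← hv] at e1
    rw [Finset.sum_sub_distrib, Finset.sum_const, nsmul_eq_mul]
    have : ((nb E r).card : ℝ) = outdeg E r := rfl
    rw [this, mul_sub, e1]
    field_simp; ring
  have hind : ∀ r, 0 ≤ 1 - ind I r := by
    intro r; unfold ind; split_ifs <;> norm_num
  have hd3 : ∀ r, (0 : ℝ) < outdeg E r := fun r => by exact_mod_cast hd r
  have hnn := max_principle hc0 hc1 E hd (fun r => 1 / (1 - c) - v r) (fun r => by
    rw [hb r]
    have := mul_nonneg (hd3 r).le (hind r)
    linarith)
  have hlt : 0 < 1 / (1 - c) - v i := by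
    obtain ⟨j, hj, hp⟩ := hacc i hi
    clear hi
    induction hp using Relation.ReflTransGen.head_induction_on with
    | refl =>
      have h1 := hb j
      have h2 : ind I j = 0 := by
        simp only [Finset.mem_compl] at hj; simp [ind, hj]
      have h3 : 0 ≤ c * ∑ k ∈ nb E j, (1 / (1 - c) - v k) :=
        mul_nonneg hc0.le (Finset.sum_nonneg fun j _ => hnn j)
      rw [h2] at h1
      refine pos_of_mul_pos_right (a := (outdeg E j : ℝ)) ?_ (hd3 j).le
      rw [h1]
      linarith [hd3 j]
    | @head a b hab _ ih =>
      have h1 := hb a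
      have h3 : 0 < c * ∑ k ∈ nb E a, (1 / (1 - c) - v k) :=
        mul_pos hc0 (Finset.sum_pos' (fun j _ => hnn j) ⟨b, (mem_nb E a b).mpr hab, ih⟩)
      refine pos_of_mul_pos_right (a := (outdeg E a : ℝ)) ?_ (hd3 a).le
      rw [h1]
      linarith [mul_nonneg (hd3 a).le (hind a)]
  have h6 : v i * (1 - c) < 1 := by
    rw [← lt_div_iff₀ hcc]; linarith
  rw [div_lt_iff₀ hc0]; linarith

/-- access to the complement of `I` without leaving from nodes `i` or `k`. -/
def acc2 {n : ℕ} (E : Finset (Fin n × Fin n)) (I : Finset (Fin n)) (i k x : Fin n) : Prop :=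
  ∃ j ∈ Iᶜ, Relation.ReflTransGen (fun a b => (a, b) ∈ E ∧ a ≠ i ∧ a ≠ k) x j

lemma acc2_step {n : ℕ} {E : Finset (Fin n × Fin n)} {I : Finset (Fin n)} {i k x y : Fin n}
    (h : acc2 E I i k y) (hxy : (x, y) ∈ E) (h1 : x ≠ i) (h2 : x ≠ k) : acc2 E I i k x := by
  obtain ⟨j, hj, hp⟩ := h
  exact ⟨j, hj, Relation.ReflTransGen.head ⟨hxy, h1, h2⟩ hp⟩

lemma acc2_refl {n : ℕ} {E : Finset (Fin n × Fin n)} {I : Finset (Fin n)} {i k x : Fin n}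
    (h : x ∉ I) : acc2 E I i k x :=
  ⟨x, by simpa using h, Relation.ReflTransGen.refl⟩

lemma acc2_mono {n : ℕ} {E : Finset (Fin n × Fin n)} {I : Finset (Fin n)} {i k x : Fin n}
    (h : acc2 E I i k x) : acc2 E I i i x ∧ acc2 E I k k x := by
  obtain ⟨j, hj, hp⟩ := h
  exact ⟨⟨j, hj, rtg_mono hp fun a b h => ⟨h.1, h.2.1, h.2.1⟩⟩,
    ⟨j, hj, rtg_mono hp fun a b h => ⟨h.1, h.2.2, h.2.2⟩⟩⟩

lemma acc2_self {n : ℕ} {E : Finset (Fin n × Fin n)} {I : Finset (Fin n)} {i : Fin n}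
    (hi : i ∈ I) : ¬ acc2 E I i i i := by
  rintro ⟨j, hj, hp⟩
  rcases Relation.ReflTransGen.cases_head hp with h | ⟨b, h, _⟩
  · subst h; simp at hj; exact hj hi
  · exact h.2.1 rfl

lemma dichotomy {n : ℕ} {E : Finset (Fin n × Fin n)} {I : Finset (Fin n)} {i m : Fin n}
    (hne : i ≠ m) (hm : m ∈ I) (hacc : access E m Iᶜ) :
    acc2 E I m m i ∨ acc2 E I i i m := by
  obtain ⟨j, hj, hp⟩ := hacc
  have : ∀ x, Relation.ReflTransGen (fun a b => (a, b) ∈ E) x j →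
      acc2 E I i m x ∨ acc2 E I m m i ∨ acc2 E I i i m := by
    intro x hx
    induction hx using Relation.ReflTransGen.head_induction_on with
    | refl => exact Or.inl (acc2_refl (by simpa using hj))
    | @head a b hab _ ih =>
      rcases ih with h | h
      · by_cases h1 : a = i
        · subst h1
          exact Or.inr (Or.inl (acc2_step (acc2_mono h).2 hab hne hne))
        · by_cases h2 : a = m
          · subst h2
            exact Or.inr (Or.inr (acc2_step (acc2_mono h).1 hab hne.symm hne.symm))
          · exact Or.inl (acc2_step h hab h1 h2)
      · exact Or.inr h
  rcases this m hp with h | h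
  · exact Or.inr (acc2_mono h).1
  · exact h

lemma exists_child {n : ℕ} {E : Finset (Fin n × Fin n)} {I : Finset (Fin n)} {i : Fin n}
    (hi : i ∈ I) (hacc : access E i Iᶜ) :
    ∃ k, (i, k) ∈ E ∧ acc2 E I i i k := by
  obtain ⟨j, hj, hp⟩ := hacc
  have : ∀ x, Relation.ReflTransGen (fun a b => (a, b) ∈ E) x j →
      acc2 E I i i x ∨ ∃ k, (i, k) ∈ E ∧ acc2 E I i i k := by
    intro x hx
    induction hx using Relation.ReflTransGen.head_induction_on with
    | refl => exact Or.inl (acc2_refl (by simpa using hj))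
    | @head a b hab _ ih =>
      rcases ih with h | h
      · by_cases h1 : a = i
        · subst h1; exact Or.inr ⟨b, hab, h⟩
        · exact Or.inl (acc2_step h hab h1 h1)
      · exact Or.inr h
  rcases this i hp with h | h
  · exact absurd h (acc2_self hi)
  · exact h

lemma outdeg_pos_of {n : ℕ} {E : Finset (Fin n × Fin n)} {i j : Fin n} (h : (i, j) ∈ E) :
    0 < outdeg E i := Finset.card_pos.mpr ⟨j, by simpa using h⟩

lemma exists_of_outdeg {n : ℕ} {E : Finset (Fin n × Fin n)} {i : Fin n} (h : 0 < outdeg E i) :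
    ∃ j, (i, j) ∈ E := by
  obtain ⟨j, hj⟩ := Finset.card_pos.mp h
  exact ⟨j, by simpa using hj⟩

lemma admissible_row {n : ℕ} {E E' : Finset (Fin n × Fin n)} {I : Finset (Fin n)} {i m : Fin n}
    (hA : admissible E I) (hrow : ∀ a b, a ≠ i → ((a, b) ∈ E' ↔ (a, b) ∈ E))
    (him : (i, m) ∈ E') (hm : acc2 E I i i m) : admissible E' I := by
  obtain ⟨hd, hacc⟩ := hA
  constructor
  · intro a
    by_cases h : a = i
    · subst h; exact outdeg_pos_of him
    · obtain ⟨b, hb⟩ := exists_of_outdeg (hd a)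
      exact outdeg_pos_of ((hrow a b h).mpr hb)
  · have hiacc : access E' i Iᶜ := by
      obtain ⟨j, hj, hp⟩ := hm
      exact ⟨j, hj, Relation.ReflTransGen.head him
        (rtg_mono hp fun a b h => (hrow a b h.2.1).mpr h.1)⟩
    intro x hx
    obtain ⟨j, hj, hp⟩ := hacc x hx
    clear hx
    induction hp using Relation.ReflTransGen.head_induction_on with
    | refl => exact ⟨j, hj, Relation.ReflTransGen.refl⟩
    | @head a b hab _ ih =>
      by_cases h : a = i
      · subst h; exact hiacc
      · obtain ⟨j', hj', hp'⟩ := ih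
        exact ⟨j', hj', Relation.ReflTransGen.head ((hrow a b h).mpr hab) hp'⟩

lemma admissible_mono {n : ℕ} {E E' : Finset (Fin n × Fin n)} {I : Finset (Fin n)}
    (hA : admissible E I) (hsub : E ⊆ E') : admissible E' I := by
  obtain ⟨hd, hacc⟩ := hA
  constructor
  · intro a
    obtain ⟨b, hb⟩ := exists_of_outdeg (hd a)
    exact outdeg_pos_of (hsub hb)
  · intro x hx
    obtain ⟨j, hj, hp⟩ := hacc x hx
    exact ⟨j, hj, rtg_mono hp fun a b h => hsub h⟩

/-- Optimality, phrased for whole graphs. -/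
def OptG {n : ℕ} (c : ℝ) (z : Fin n → ℝ) (E : Finset (Fin n × Fin n)) (I : Finset (Fin n)) : Prop :=
  ∀ E' : Finset (Fin n × Fin n), (∀ a b, ¬ (a ∈ I ∧ b ∈ I) → ((a, b) ∈ E' ↔ (a, b) ∈ E)) →
    admissible E' I → prSet c z E' I ≤ prSet c z E I

lemma sum_nb_zero {n : ℕ} {c : ℝ} (hc0 : 0 < c) (hc1 : c < 1)
    (E : Finset (Fin n × Fin n)) (I : Finset (Fin n))
    (hd : ∀ i, 0 < outdeg E i) (i : Fin n) (hi : i ∈ I) :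
    ∑ j ∈ nb E i, (vvec c E I j - (vvec c E I i - 1) / c) = 0 := by
  have e1 := vvec_eq hc0 hc1 E hd I i
  have hI1 : ind I i = 1 := by simp [ind, hi]
  rw [hI1] at e1
  rw [Finset.sum_sub_distrib, Finset.sum_const, nsmul_eq_mul]
  have : ((nb E i).card : ℝ) = outdeg E i := rfl
  rw [this]
  field_simp
  linarith

/-- Nodes of `I` at least as good as `i` are linked from `i`. -/
lemma link_up {n : ℕ} {c : ℝ} (hc0 : 0 < c) (hc1 : c < 1) (z : Fin n → ℝ) (hz : ∀ i, 0 < z i)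
    (E : Finset (Fin n × Fin n)) (I : Finset (Fin n)) (hA : admissible E I) (hO : OptG c z E I)
    (i j : Fin n) (hi : i ∈ I) (hj : j ∈ I) (hij : vvec c E I i ≤ vvec c E I j) : (i, j) ∈ E := by
  by_contra hn
  have hA' : admissible (insert (i, j) E) I := admissible_mono hA (Finset.subset_insert _ _)
  have h1 := hO (insert (i, j) E) (by
    intro a b hab
    simp only [Finset.mem_insert, Prod.mk.injEq]
    constructor
    · rintro (⟨rfl, rfl⟩ | h)
      · exact absurd ⟨hi, hj⟩ hab
      · exact h
    · exact Or.inr) hA'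
  have h2 := improve hc0 hc1 z hz E _ I hA.1 hA'.1 i hi (by
    intro a b hab
    simp [hab]) h1
  have h3 : nb (insert (i, j) E) i = insert j (nb E i) := by
    ext b; simp [mem_nb]
  rw [h3, Finset.sum_insert (by simpa [mem_nb] using hn), sum_nb_zero hc0 hc1 E I hA.1 i hi] at h2
  have := v_gt_avg hc0 hc1 E I hA i hi
  linarith

/-- Exchange argument for a non-leaking node. -/
lemma exchange {n : ℕ} {c : ℝ} (hc0 : 0 < c) (hc1 : c < 1) (z : Fin n → ℝ) (hz : ∀ i, 0 < z i)
    (E : Finset (Fin n × Fin n)) (I : Finset (Fin n)) (hA : admissible E I) (hO : OptG c z E I)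
    (i : Fin n) (hi : i ∈ I) (hnl : ∀ j, (i, j) ∈ E → j ∈ I)
    (S : Finset (Fin n)) (hS : S ⊆ I) (m : Fin n) (hmS : m ∈ S) (hm : acc2 E I i i m) :
    ∑ j ∈ S, (vvec c E I j - (vvec c E I i - 1) / c) ≤ 0 := by
  set E' := E.filter (fun p => p.1 ≠ i) ∪ S.image (fun j => (i, j)) with hE'
  have hmem : ∀ a b, (a, b) ∈ E' ↔ ((a, b) ∈ E ∧ a ≠ i) ∨ (b ∈ S ∧ i = a) := by
    intro a b; simp [hE']
  have hrow : ∀ a b, a ≠ i → ((a, b) ∈ E' ↔ (a, b) ∈ E) := by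
    intro a b h
    rw [hmem]
    constructor
    · rintro (h1 | h1)
      · exact h1.1
      · exact absurd h1.2.symm h
    · intro h1; exact Or.inl ⟨h1, h⟩
  have hA' : admissible E' I := admissible_row hA hrow ((hmem i m).mpr (Or.inr ⟨hmS, rfl⟩)) hm
  have h1 := hO E' (by
    intro a b hab
    by_cases h : a = i
    · subst h
      have hb : b ∉ I := fun hb => hab ⟨hi, hb⟩
      constructor
      · intro h2
        rcases (hmem _ _).mp h2 with h2 | h2
        · exact h2.1
        · exact absurd (hS h2.1) hb
      · intro h2; exact absurd (hnl b h2) hb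
    · exact hrow a b h) hA'
  have h2 := improve hc0 hc1 z hz E E' I hA.1 hA'.1 i hi hrow h1
  have h3 : nb E' i = S := by
    ext b; rw [mem_nb, hmem]; simp
  rwa [h3] at h2

lemma no_acc {n : ℕ} {c : ℝ} (hc0 : 0 < c) (hc1 : c < 1) (z : Fin n → ℝ) (hz : ∀ i, 0 < z i)
    (E : Finset (Fin n × Fin n)) (I : Finset (Fin n)) (hA : admissible E I) (hO : OptG c z E I)
    (i : Fin n) (hi : i ∈ I) (hnl : ∀ j, (i, j) ∈ E → j ∈ I) (m : Fin n) (hm : m ∈ I) (hv : vvec c E I i ≤ vvec c E I m) : ¬ acc2 E I i i m := by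
  intro h
  have := exchange hc0 hc1 z hz E I hA hO i hi hnl {m} (by simpa using hm) m (by simp) h
  have h2 := v_gt_avg hc0 hc1 E I hA i hi
  rw [Finset.sum_singleton] at this
  linarith

lemma leak_acc {n : ℕ} {E : Finset (Fin n × Fin n)} {I : Finset (Fin n)} {i m j : Fin n}
    (hne : m ≠ i) (hj : j ∉ I) (hmj : (m, j) ∈ E) : acc2 E I i i m :=
  acc2_step (acc2_refl hj) hmj hne hne

lemma nonleak_ne {n : ℕ} {c : ℝ} (hc0 : 0 < c) (hc1 : c < 1) (z : Fin n → ℝ) (hz : ∀ i, 0 < z i)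
    (E : Finset (Fin n × Fin n)) (I : Finset (Fin n)) (hA : admissible E I) (hO : OptG c z E I)
    (i : Fin n) (hi : i ∈ I) (hnl : ∀ j, (i, j) ∈ E → j ∈ I) (m : Fin n) (hm : m ∈ I)
    (hne : m ≠ i) (hv : vvec c E I i ≤ vvec c E I m) :
    (∀ j, (m, j) ∈ E → j ∈ I) ∧ vvec c E I i < vvec c E I m := by
  have h1 := no_acc hc0 hc1 z hz E I hA hO i hi hnl m hm hv
  have h2 : ∀ j, (m, j) ∈ E → j ∈ I := by
    intro j hj
    by_contra hjI
    exact h1 (leak_acc hne hjI hj)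
  refine ⟨h2, ?_⟩
  by_contra hle
  push Not at hle
  have h3 := no_acc hc0 hc1 z hz E I hA hO m hm h2 i hi hle
  rcases dichotomy (E := E) (I := I) hne.symm hm (hA.2 m hm) with h | h
  · exact h3 h
  · exact h1 h

lemma acc_of_lt {n : ℕ} {c : ℝ} (hc0 : 0 < c) (hc1 : c < 1) (z : Fin n → ℝ) (hz : ∀ i, 0 < z i)
    (E : Finset (Fin n × Fin n)) (I : Finset (Fin n)) (hA : admissible E I) (hO : OptG c z E I)
    (i : Fin n) (hi : i ∈ I) (m : Fin n) (hm : m ∈ I)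
    (hv : vvec c E I m < vvec c E I i) : acc2 E I i i m := by
  have hne : m ≠ i := by rintro rfl; exact lt_irrefl _ hv
  by_cases h2 : ∀ j, (m, j) ∈ E → j ∈ I
  · have h3 := no_acc hc0 hc1 z hz E I hA hO m hm h2 i hi hv.le
    rcases dichotomy (E := E) (I := I) hne.symm hm (hA.2 m hm) with h | h
    · exact absurd h h3
    · exact h
  · push Not at h2
    obtain ⟨j, hj, hjI⟩ := h2
    exact leak_acc hne hjI hj

lemma nonleak_next {n : ℕ} {c : ℝ} (hc0 : 0 < c) (hc1 : c < 1) (z : Fin n → ℝ) (hz : ∀ i, 0 < z i)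
    (E : Finset (Fin n × Fin n)) (I : Finset (Fin n)) (hA : admissible E I) (hO : OptG c z E I)
    (i : Fin n) (hi : i ∈ I) (hnl : ∀ j, (i, j) ∈ E → j ∈ I) :
    ∃ k ∈ I, (i, k) ∈ E ∧ vvec c E I k < vvec c E I i ∧
      (∀ m ∈ I, vvec c E I m < vvec c E I i → vvec c E I m ≤ vvec c E I k) ∧
      ∀ m, (i, m) ∈ E → vvec c E I m < vvec c E I i → m = k := by
  obtain ⟨k, hk, hka⟩ := exists_child (E := E) hi (hA.2 i hi)
  have hkI := hnl k hk
  have hkv : vvec c E I k < vvec c E I i := by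
    by_contra h
    push Not at h
    exact no_acc hc0 hc1 z hz E I hA hO i hi hnl k hkI h hka
  have hsub : nb E i ⊆ I := fun j hj => hnl j ((mem_nb E i j).mp hj)
  have h0 := sum_nb_zero hc0 hc1 E I hA.1 i hi
  have hgt := v_gt_avg hc0 hc1 E I hA i hi
  have hii := link_up hc0 hc1 z hz E I hA hO i i hi hi le_rfl
  -- if there are two lower children then every lower child is at least average
  have two : ∀ d d', (i, d) ∈ E → (i, d') ∈ E → d ≠ d' → vvec c E I d' < vvec c E I i →
      (vvec c E I i - 1) / c ≤ vvec c E I d := by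
    intro d d' hd hd' hne hlt
    have h1 := exchange hc0 hc1 z hz E I hA hO i hi hnl ((nb E i).erase d)
      (fun j hj => hsub (Finset.mem_of_mem_erase hj)) d'
      (Finset.mem_erase.mpr ⟨hne.symm, (mem_nb E i d').mpr hd'⟩)
      (acc_of_lt hc0 hc1 z hz E I hA hO i hi d' (hnl d' hd') hlt)
    have h2 := Finset.add_sum_erase (nb E i)
      (fun j => vvec c E I j - (vvec c E I i - 1) / c) ((mem_nb E i d).mpr hd)
    linarith
  have uniq : ∀ m, (i, m) ∈ E → vvec c E I m < vvec c E I i → m = k := by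
    intro m hm hmv
    by_contra hne
    have hall : ∀ j ∈ nb E i, 0 ≤ vvec c E I j - (vvec c E I i - 1) / c := by
      intro j hj
      have hj' := (mem_nb E i j).mp hj
      by_cases hjk : j = k
      · subst hjk
        linarith [two j m hj' hm (Ne.symm hne) hmv]
      · linarith [two j k hj' hk hjk hkv]
    have := Finset.sum_pos' hall ⟨i, (mem_nb E i i).mpr hii, by linarith⟩
    linarith
  refine ⟨k, hkI, hk, hkv, ?_, uniq⟩
  intro m hm hmv
  by_cases hmk : m = k
  · rw [hmk]
  have hmn : m ∉ nb E i := fun h => hmk (uniq m ((mem_nb E i m).mp h) hmv)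
  have h1 := exchange hc0 hc1 z hz E I hA hO i hi hnl (insert m ((nb E i).erase k))
    (by
      intro j hj
      rcases Finset.mem_insert.mp hj with rfl | hj
      · exact hm
      · exact hsub (Finset.mem_of_mem_erase hj)) m (Finset.mem_insert_self _ _)
      (acc_of_lt hc0 hc1 z hz E I hA hO i hi m hm hmv)
  rw [Finset.sum_insert (fun h => hmn (Finset.mem_of_mem_erase h))] at h1
  have h2 := Finset.add_sum_erase (nb E i)
      (fun j => vvec c E I j - (vvec c E I i - 1) / c) ((mem_nb E i k).mpr hk)
  linarith

lemma sorted_enum {n : ℕ} {α : Type*} [LinearOrder α] (key : Fin n → α)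
    (hkey : Function.Injective key) (I : Finset (Fin n)) :
    ∃ φ : Fin I.card → Fin n, (∀ x, x ∈ I ↔ ∃ k, φ k = x) ∧ StrictMono (fun k => key (φ k)) := by
  classical
  have hcard : (I.image key).card = I.card := Finset.card_image_of_injective I hkey
  let e := (I.image key).orderEmbOfFin hcard
  have he : ∀ k, ∃ x ∈ I, key x = e k := fun k =>
    Finset.mem_image.mp (Finset.orderEmbOfFin_mem (I.image key) hcard k)
  choose φ hφ hφ2 using he
  refine ⟨φ, fun x => ⟨fun hx => ?_, ?_⟩, ?_⟩
  · have : key x ∈ Set.range e := by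
      rw [Finset.range_orderEmbOfFin]
      exact Finset.mem_coe.mpr (Finset.mem_image_of_mem key hx)
    obtain ⟨k, hk⟩ := this
    exact ⟨k, hkey ((hφ2 k).trans hk)⟩
  · rintro ⟨k, rfl⟩; exact hφ k
  · intro a b hab
    simp only [hφ2]
    exact e.strictMono hab

lemma upper_count {N : ℕ} (A : Finset (Fin N)) (hup : ∀ k l, k ∈ A → k ≤ l → l ∈ A) (k : Fin N) :
    k ∈ A ↔ N - A.card ≤ (k : ℕ) := by
  constructor
  · intro hk
    have : Finset.Ici k ⊆ A := fun l hl => hup k l hk (Finset.mem_Ici.mp hl)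
    have := Finset.card_le_card this
    rw [Fin.card_Ici] at this
    omega
  · intro h
    by_contra hk
    have : A ⊆ Finset.Ioi k := fun l hl => by
      rw [Finset.mem_Ioi]
      by_contra hlk
      exact hk (hup l k hl (not_lt.mp hlk))
    have := Finset.card_le_card this
    rw [Fin.card_Ioi] at this
    have := k.2
    omega

lemma core {n : ℕ} {c : ℝ} (hc0 : 0 < c) (hc1 : c < 1) (z : Fin n → ℝ) (hz : ∀ i, 0 < z i)
    (E : Finset (Fin n × Fin n)) (I : Finset (Fin n)) (hA : admissible E I) (hO : OptG c z E I)
    (L : Finset (Fin n)) (hL : ∀ i, i ∈ L ↔ i ∈ I ∧ ∃ j, j ∉ I ∧ (i, j) ∈ E) :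
    ∃ φ : Fin I.card → Fin n, Function.Injective φ ∧
      (∀ x : Fin n, x ∈ I ↔ ∃ k, φ k = x) ∧
      (∀ k : Fin I.card, (φ k ∈ L ↔ I.card - L.card ≤ (k : ℕ))) ∧
      (∀ k : Fin I.card, ∀ hk : (k : ℕ) + 1 < I.card,
        ((k : ℕ) + 1 ≤ I.card - L.card →
          vvec c E I (φ ⟨(k : ℕ) + 1, hk⟩) < vvec c E I (φ k)) ∧
        vvec c E I (φ ⟨(k : ℕ) + 1, hk⟩) ≤ vvec c E I (φ k)) ∧
      (∀ k l : Fin I.card,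
        ((l : ℕ) ≤ (k : ℕ) ∨ ((l : ℕ) = (k : ℕ) + 1 ∧ φ k ∉ L)) → (φ k, φ l) ∈ E) ∧
      (∀ k l : Fin I.card, (φ k, φ l) ∈ E → 
        ((l : ℕ) ≤ (k : ℕ) ∨ ((l : ℕ) = (k : ℕ) + 1 ∧ φ k ∉ L) ∨
          (φ k ∈ L ∧ φ l ∈ L ∧ (k : ℕ) < (l : ℕ)))) := by
  classical
  have hnl : ∀ i ∈ I, i ∉ L → ∀ j, (i, j) ∈ E → j ∈ I := by
    intro i hi hiL j hj
    by_contra h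
    exact hiL ((hL i).mpr ⟨hi, j, h, hj⟩)
  have hne := fun i hi hiL => nonleak_ne hc0 hc1 z hz E I hA hO i hi (hnl i hi hiL)
  have hnext := fun i hi hiL => nonleak_next hc0 hc1 z hz E I hA hO i hi (hnl i hi hiL)
  have hup := link_up hc0 hc1 z hz E I hA hO
  generalize vvec c E I = v at *
  let t : Fin n → ℕ := fun x => if ∃ i ∈ I, i ∉ L ∧ (i, x) ∈ E ∧ v x < v i then 0 else 1
  let key : Fin n → ℝᵒᵈ ×ₗ (ℕ ×ₗ Fin n) := fun x => toLex (OrderDual.toDual (v x), toLex (t x, x))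
  have hkey : Function.Injective key := by
    intro x y h
    have h1 := congrArg (fun p => (ofLex (ofLex p).2).2) h
    exact h1
  have hkey1 : ∀ x y, key x < key y → v y ≤ v x := by
    intro x y h
    rcases (Prod.Lex.toLex_lt_toLex).mp h with h | h
    · exact (OrderDual.toDual_lt_toDual.mp h).le
    · exact (OrderDual.toDual.injective h.1).symm.le
  have hkey2 : ∀ x y, key x < key y → v x = v y → t x ≤ t y := by
    intro x y h hv
    rcases (Prod.Lex.toLex_lt_toLex).mp h with h | h
    · exact absurd (OrderDual.toDual_lt_toDual.mp h) (by simp [hv])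
    · rcases (Prod.Lex.toLex_lt_toLex).mp h.2 with h | h
      · exact le_of_lt h
      · exact le_of_eq h.1
  obtain ⟨φ, hφ, hmono⟩ := sorted_enum key hkey I
  have hinj : Function.Injective φ := fun a b h => hmono.injective (congrArg key h)
  have hφI : ∀ k, φ k ∈ I := fun k => (hφ _).mpr ⟨k, rfl⟩
  have hle : ∀ k l : Fin I.card, k ≤ l → v (φ l) ≤ v (φ k) := by
    intro k l h
    rcases h.eq_or_lt with rfl | h
    · exact le_rfl
    · exact hkey1 _ _ (hmono h)
  have hlt : ∀ k l : Fin I.card, φ k ∉ L → k < l → v (φ l) < v (φ k) := by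
    intro k l hk h
    by_contra hc
    push Not at hc
    have h2 := (hne (φ k) (hφI k) hk (φ l) (hφI l) (fun h' => h.ne' (hinj h')) hc).2
    exact absurd (hle k l h.le) (not_le.mpr h2)
  have hLup : ∀ k l : Fin I.card, φ k ∈ L → k ≤ l → φ l ∈ L := by
    intro k l hk h
    rcases h.eq_or_lt with rfl | h
    · exact hk
    by_contra hl
    have h2 := (hne (φ l) (hφI l) hl (φ k) (hφI k) (fun h' => h.ne (hinj h')) (hle k l h.le)).1
    obtain ⟨-, j, hj, hkj⟩ := (hL _).mp hk
    exact hj (h2 j hkj)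
  have hcount : ∀ k : Fin I.card, (φ k ∈ L ↔ I.card - L.card ≤ (k : ℕ)) := by
    intro k
    have h1 := upper_count (Finset.univ.filter fun k => φ k ∈ L) (by
      intro a b ha hab
      simp only [Finset.mem_filter, Finset.mem_univ, true_and] at ha ⊢
      exact hLup a b ha hab) k
    have h2 : (Finset.univ.filter fun k => φ k ∈ L).card = L.card := by
      rw [← Finset.card_image_of_injective _ hinj]
      congr 1
      ext x
      simp only [Finset.mem_image, Finset.mem_filter, Finset.mem_univ, true_and]
      constructor
      · rintro ⟨a, ha, rfl⟩; exact ha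
      · intro hx
        obtain ⟨a, rfl⟩ := (hφ x).mp ((hL x).mp hx).1
        exact ⟨a, hx, rfl⟩
    rw [h2] at h1
    simpa using h1
  have hsucc : ∀ k l : Fin I.card, (l : ℕ) = (k : ℕ) + 1 → φ k ∉ L → (φ k, φ l) ∈ E := by
    intro k l hkl hk
    have hkl' : k < l := by rw [Fin.lt_def]; omega
    have hvl := hlt k l hk hkl'
    obtain ⟨x, hxI, hxE, hxv, hmax, huniq⟩ := hnext (φ k) (hφI k) hk
    obtain ⟨q, rfl⟩ := (hφ x).mp hxI
    have hq : l ≤ q := by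
      by_contra hq
      have : q ≤ k := by rw [Fin.le_def]; rw [Fin.le_def] at hq; omega
      exact absurd (hle q k this) (not_le.mpr hxv)
    rcases hq.eq_or_lt with rfl | hq
    · exact hxE
    have hveq : v (φ l) = v (φ q) := le_antisymm (hmax _ (hφI l) hvl) (hle l q hq.le)
    have ht := hkey2 _ _ (hmono hq) hveq
    have htq : t (φ q) = 0 := if_pos ⟨φ k, hφI k, hk, hxE, hxv⟩
    have htl : ∃ i ∈ I, i ∉ L ∧ (i, φ l) ∈ E ∧ v (φ l) < v i := by
      by_contra hno
      have : t (φ l) = 1 := if_neg hno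
      omega
    obtain ⟨i, hiI, hiL, hiE, hiv⟩ := htl
    have hik : i = φ k := by
      by_contra hik
      rcases lt_or_ge (v i) (v (φ k)) with h | h
      · have := hmax i hiI h
        linarith
      · have h2 := (hne (φ k) (hφI k) hk i hiI hik h).2
        obtain ⟨x, hxI', hxE', hxv', hmax', huniq'⟩ := hnext i hiI hiL
        have h3 := huniq' _ hiE hiv
        have h4 := hmax' _ (hφI k) h2
        rw [← h3] at h4
        linarith
    rw [← hik]; exact hiE
  refine ⟨φ, hinj, hφ, hcount, ?_, ?_, ?_⟩
  · intro k hk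
    have hkk : k < ⟨(k : ℕ) + 1, hk⟩ := by rw [Fin.lt_def]; simp
    refine ⟨fun h => hlt _ _ ?_ hkk, hle _ _ hkk.le⟩
    rw [hcount]; omega
  · rintro k l (h | ⟨h, hk⟩)
    · exact hup _ _ (hφI k) (hφI l) (hle l k h)
    · exact hsucc k l h hk
  · intro k l hE
    rcases le_or_gt l k with h | h
    · exact Or.inl h
    by_cases hk : φ k ∈ L
    · exact Or.inr (Or.inr ⟨hk, hLup k l hk h.le, h⟩)
    · refine Or.inr (Or.inl ⟨?_, hk⟩)
      have h' : (k : ℕ) < (l : ℕ) := h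
      have hb : (k : ℕ) + 1 < I.card := by have := l.2; omega
      have hkk : k < ⟨(k : ℕ) + 1, hb⟩ := by rw [Fin.lt_def]; simp
      have h1 := hsucc k ⟨(k : ℕ) + 1, hb⟩ rfl hk
      obtain ⟨x, hxI, hxE, hxv, hmax, huniq⟩ := hnext (φ k) (hφI k) hk
      have h2 := huniq _ h1 (hlt _ _ hk hkk)
      have h3 := huniq _ hE (hlt _ _ hk h)
      have h4 := hinj (h3.trans h2.symm)
      rw [h4]

/-- Theorem 11 (Optimal internal link structure): with `E_out(I)`, `E_in(I)`, `E_Ī`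
fixed, `L` the set of leaking nodes, every optimal internal link set `H` admits a
relabeling `φ : Fin n_I → I` of the nodes of `I` under which `L` consists of the last
`n_L` labels, `v` is strictly decreasing on non-leaking labels down to the first leaking
label and non-increasing afterwards, and `E_I^L ⊆ H ⊆ E_I^U`. -/
theorem stmt12 {n : ℕ} (hn : 1 ≤ n) (c : ℝ) (hc0 : 0 < c) (hc1 : c < 1)
    (z : Fin n → ℝ) (hz : ∀ i, 0 < z i) (hz1 : ∑ i, z i = 1)
    (I : Finset (Fin n)) (hI : I.Nonempty) (hIc : (Iᶜ : Finset (Fin n)).Nonempty)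
    (Eout Ein Eext : Finset (Fin n × Fin n))
    (hEout : ∀ p ∈ Eout, p.1 ∈ I ∧ p.2 ∉ I)
    (hEin : ∀ p ∈ Ein, p.1 ∉ I ∧ p.2 ∈ I)
    (hEext : ∀ p ∈ Eext, p.1 ∉ I ∧ p.2 ∉ I)
    (L : Finset (Fin n)) (hL : L = Eout.image Prod.fst)
    (H : Finset (Fin n × Fin n)) (hH : ∀ p ∈ H, p.1 ∈ I ∧ p.2 ∈ I)
    (hAdm : admissible (H ∪ Eout ∪ Ein ∪ Eext) I)
    (hOpt : ∀ H' : Finset (Fin n × Fin n), (∀ p ∈ H', p.1 ∈ I ∧ p.2 ∈ I) →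
      admissible (H' ∪ Eout ∪ Ein ∪ Eext) I →
      prSet c z (H' ∪ Eout ∪ Ein ∪ Eext) I ≤ prSet c z (H ∪ Eout ∪ Ein ∪ Eext) I) :
    ∃ φ : Fin I.card → Fin n, Function.Injective φ ∧
      (∀ x : Fin n, x ∈ I ↔ ∃ k, φ k = x) ∧
      (∀ k : Fin I.card, (φ k ∈ L ↔ I.card - L.card ≤ (k : ℕ))) ∧
      (∀ k : Fin I.card, ∀ hk : (k : ℕ) + 1 < I.card,
        ((k : ℕ) + 1 ≤ I.card - L.card →
          vvec c (H ∪ Eout ∪ Ein ∪ Eext) I (φ ⟨(k : ℕ) + 1, hk⟩) <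
            vvec c (H ∪ Eout ∪ Ein ∪ Eext) I (φ k)) ∧
        vvec c (H ∪ Eout ∪ Ein ∪ Eext) I (φ ⟨(k : ℕ) + 1, hk⟩) ≤
          vvec c (H ∪ Eout ∪ Ein ∪ Eext) I (φ k)) ∧
      (∀ k l : Fin I.card,
        ((l : ℕ) ≤ (k : ℕ) ∨ ((l : ℕ) = (k : ℕ) + 1 ∧ φ k ∉ L)) → (φ k, φ l) ∈ H) ∧
      (∀ p ∈ H, ∃ k l : Fin I.card, p = (φ k, φ l) ∧
        ((l : ℕ) ≤ (k : ℕ) ∨ ((l : ℕ) = (k : ℕ) + 1 ∧ φ k ∉ L) ∨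
          (φ k ∈ L ∧ φ l ∈ L ∧ (k : ℕ) < (l : ℕ)))) := by
  have hmE : ∀ H' : Finset (Fin n × Fin n), (∀ p ∈ H', p.1 ∈ I ∧ p.2 ∈ I) → ∀ a b,
      a ∈ I → b ∈ I → ((a, b) ∈ H' ∪ Eout ∪ Ein ∪ Eext ↔ (a, b) ∈ H') := by
    intro H' _ a b ha hb
    simp only [Finset.mem_union]
    constructor
    · rintro (((h | h) | h) | h)
      · exact h
      · exact absurd hb (hEout _ h).2
      · exact absurd ha (hEin _ h).1
      · exact absurd ha (hEext _ h).1
    · intro h; exact Or.inl (Or.inl (Or.inl h))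
  have hO : OptG c z (H ∪ Eout ∪ Ein ∪ Eext) I := by
    intro E' hE' hA'
    have hinner : ∀ p ∈ E'.filter (fun p => p.1 ∈ I ∧ p.2 ∈ I), p.1 ∈ I ∧ p.2 ∈ I :=
      fun p hp => (Finset.mem_filter.mp hp).2
    have heq : E'.filter (fun p => p.1 ∈ I ∧ p.2 ∈ I) ∪ Eout ∪ Ein ∪ Eext = E' := by
      ext ⟨a, b⟩
      by_cases hab : a ∈ I ∧ b ∈ I
      · rw [hmE _ hinner a b hab.1 hab.2]
        simp [hab]
      · rw [hE' a b hab]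
        have h1 : (a, b) ∉ H := fun h => hab (hH _ h)
        have h2 : (a, b) ∉ E'.filter (fun p => p.1 ∈ I ∧ p.2 ∈ I) := fun h => hab (hinner _ h)
        simp only [Finset.mem_union, h1, h2]
    have := hOpt _ hinner (by rw [heq]; exact hA')
    rwa [heq] at this
  obtain ⟨φ, h1, h2, h3, h4, h5, h6⟩ := core hc0 hc1 z hz (H ∪ Eout ∪ Ein ∪ Eext) I hAdm hO L (by
    intro i
    rw [hL, Finset.mem_image]
    constructor
    · rintro ⟨⟨a, b⟩, hp, rfl⟩
      exact ⟨(hEout _ hp).1, b, (hEout _ hp).2, by simp [hp]⟩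
    · rintro ⟨hi, j, hj, hij⟩
      refine ⟨(i, j), ?_, rfl⟩
      simp only [Finset.mem_union] at hij
      rcases hij with ((h | h) | h) | h
      · exact absurd (hH _ h).2 hj
      · exact h
      · exact absurd hi (hEin _ h).1
      · exact absurd hi (hEext _ h).1)
  have hφI : ∀ k, φ k ∈ I := fun k => (h2 _).mpr ⟨k, rfl⟩
  refine ⟨φ, h1, h2, h3, h4, ?_, ?_⟩
  · intro k l h
    exact (hmE H hH _ _ (hφI k) (hφI l)).mp (h5 k l h)
  · rintro ⟨a, b⟩ hp
    obtain ⟨k, rfl⟩ := (h2 a).mp (hH _ hp).1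
    obtain ⟨l, rfl⟩ := (h2 b).mp (hH _ hp).2
    exact ⟨k, l, rfl, h6 k l ((hmE H hH _ _ (hφI k) (hφI l)).mpr hp)⟩
end

section
/- Optimal link structure with no self-links: assume |I| ≥ 2, Ī is nonempty, and fix E_in(I) and E_Ī such that every node of Ī has at least one outlink in E_in(I) ∪ E_Ī. Call a pair (H, F) admissible if it is admissible in the usual sense and moreover (i,i) ∉ H for every i ∈ I; let (H, F) maximize the PageRank of I among such pairs, and let v be computed in its graph. Then there is a relabeling of the nodes of N under which I = {1, 2, …, n_I}, v_1 > v_2 > … > v_{n_I} > v_{n_I + 1} ≥ … ≥ v_n, H = {(i,j) ∈ I×I : j < i or j = i+1}, and F = {(n_I, n_I + 1)}. -/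
open Matrix Finset

/-- out-neighbours -/
def outS {n : ℕ} (E : Finset (Fin n × Fin n)) (i : Fin n) : Finset (Fin n) :=
  Finset.univ.filter (fun j => (i, j) ∈ E)

lemma mem_outS {n : ℕ} {E : Finset (Fin n × Fin n)} {i j : Fin n} : j ∈ outS E i ↔ (i, j) ∈ E := by
  simp [outS]

lemma outdeg_eq {n : ℕ} (E : Finset (Fin n × Fin n)) (i : Fin n) : outdeg E i = (outS E i).card := rfl

lemma Pmul {n : ℕ} (E : Finset (Fin n × Fin n)) (w : Fin n → ℝ) (i : Fin n) :
    (Pmat E *ᵥ w) i = ((outS E i).card : ℝ)⁻¹ * ∑ j ∈ outS E i, w j := by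
  simp only [Matrix.mulVec, dotProduct, Pmat, outdeg_eq]
  rw [Finset.mul_sum, outS, Finset.sum_filter]
  apply Finset.sum_congr rfl
  intro j _
  split_ifs <;> simp

lemma maxprin {n : ℕ} (c : ℝ) (hc0 : 0 < c) (hc1 : c < 1) (E : Finset (Fin n × Fin n))
    (hE : ∀ i, 0 < outdeg E i) (w : Fin n → ℝ)
    (hw : ∀ i, c * (Pmat E *ᵥ w) i ≤ w i) : ∀ i, 0 ≤ w i := by
  intro i
  obtain ⟨m, -, hm⟩ := Finset.exists_min_image Finset.univ w ⟨i, Finset.mem_univ i⟩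
  have hpos : (0 : ℝ) < (outS E m).card := by exact_mod_cast hE m
  have h1 : w m ≤ (Pmat E *ᵥ w) m := by
    rw [Pmul]
    have : ((outS E m).card : ℝ) * w m ≤ ∑ j ∈ outS E m, w j := by
      have := Finset.card_nsmul_le_sum (outS E m) w (w m) (fun x _ => hm x (Finset.mem_univ x))
      simpa using this
    rw [le_inv_mul_iff₀ hpos]
    exact this
  have h2 := hw m
  have h3 := hm i (Finset.mem_univ i)
  have : c * w m ≤ w m := le_trans (mul_le_mul_of_nonneg_left h1 hc0.le) h2
  nlinarith

lemma inv_unit {n : ℕ} (c : ℝ) (hc0 : 0 < c) (hc1 : c < 1) (E : Finset (Fin n × Fin n))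
    (hE : ∀ i, 0 < outdeg E i) : IsUnit (1 - c • Pmat E) := by
  rw [← Matrix.mulVec_injective_iff_isUnit]
  have key : ∀ w : Fin n → ℝ, (1 - c • Pmat E) *ᵥ w = 0 → ∀ i, 0 ≤ w i := by
    intro w hw
    apply maxprin c hc0 hc1 E hE
    intro i
    have := congrFun hw i
    simp [Matrix.sub_mulVec, Matrix.smul_mulVec] at this
    linarith
  intro x y hxy
  have h0 : (1 - c • Pmat E) *ᵥ (x - y) = 0 := by
    rw [Matrix.mulVec_sub, sub_eq_zero]; exact hxy
  have h1 : (1 - c • Pmat E) *ᵥ (y - x) = 0 := by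
    rw [Matrix.mulVec_sub, sub_eq_zero]; exact hxy.symm
  funext i
  have a := key _ h0 i
  have b := key _ h1 i
  simp at a b
  linarith

lemma v_eq {n : ℕ} (c : ℝ) (hc0 : 0 < c) (hc1 : c < 1) (E : Finset (Fin n × Fin n))
    (hE : ∀ i, 0 < outdeg E i) (I : Finset (Fin n)) (i : Fin n) :
    vvec c E I i = ind I i + c * (Pmat E *ᵥ vvec c E I) i := by
  have h : (1 - c • Pmat E) *ᵥ vvec c E I = ind I := by
    rw [vvec, Matrix.mulVec_mulVec, Matrix.mul_nonsing_inv _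
      ((Matrix.isUnit_iff_isUnit_det _).1 (inv_unit c hc0 hc1 E hE)), Matrix.one_mulVec]
  have := congrFun h i
  simp [Matrix.sub_mulVec, Matrix.smul_mulVec] at this
  linarith

lemma improve_s17 {n : ℕ} (c : ℝ) (hc0 : 0 < c) (hc1 : c < 1) (z : Fin n → ℝ) (hz : ∀ i, 0 < z i)
    (I : Finset (Fin n)) (E E' : Finset (Fin n × Fin n)) 
    (hE' : ∀ i, 0 < outdeg E' i)
    (hle : ∀ i, vvec c E I i ≤ ind I i + c * (Pmat E' *ᵥ vvec c E I) i)
    (i₀ : Fin n) (hlt : vvec c E I i₀ < ind I i₀ + c * (Pmat E' *ᵥ vvec c E I) i₀) :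
    prSet c z E I < prSet c z E' I := by
  have hv' := v_eq c hc0 hc1 E' hE' I
  set v := vvec c E I
  set v' := vvec c E' I
  have hsub : ∀ i, (Pmat E' *ᵥ (v' - v)) i = (Pmat E' *ᵥ v') i - (Pmat E' *ᵥ v) i := by
    intro i; rw [Matrix.mulVec_sub]; rfl
  have h0 : ∀ i, 0 ≤ (v' - v) i := by
    apply maxprin c hc0 hc1 E' hE'
    intro i
    rw [hsub, Pi.sub_apply]
    have := hle i; have := hv' i; linarith
  have hP : 0 ≤ (Pmat E' *ᵥ (v' - v)) i₀ := by
    rw [Pmul]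
    exact mul_nonneg (by positivity) (Finset.sum_nonneg fun i _ => h0 i)
  have h1 : v i₀ < v' i₀ := by
    rw [hsub] at hP
    have := hv' i₀
    nlinarith
  rw [prSet_eq, prSet_eq]
  apply mul_lt_mul_of_pos_left _ (by linarith)
  apply Finset.sum_lt_sum
  · intro i _
    have := h0 i
    simp at this
    exact mul_le_mul_of_nonneg_left this (hz i).le
  · exact ⟨i₀, Finset.mem_univ _, mul_lt_mul_of_pos_left h1 (hz i₀)⟩

/-- every value is at most `1/(1-c)`, strictly under access -/
lemma v_lt {n : ℕ} (c : ℝ) (hc0 : 0 < c) (hc1 : c < 1) (E : Finset (Fin n × Fin n))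
    (I : Finset (Fin n)) (hA : admissible E I) (i : Fin n) (hi : i ∈ I) :
    (1 - c) * vvec c E I i < 1 := by
  have hE := hA.1
  have hv := v_eq c hc0 hc1 E hE I
  set v := vvec c E I
  have hc : 0 < 1 - c := by linarith
  have hPle : ∀ i, (∀ j, (1 - c) * v j ≤ 1) → (1 - c) * (Pmat E *ᵥ v) i ≤ 1 := by
    intro i hb
    have hpos : (0 : ℝ) < (outS E i).card := by exact_mod_cast hE i
    rw [Pmul]
    have := Finset.sum_le_card_nsmul (outS E i) (fun j => (1 - c) * v j) 1 (fun x _ => hb x)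
    rw [← Finset.mul_sum] at this
    simp at this
    rw [mul_left_comm, inv_mul_le_iff₀ hpos]
    linarith
  have hb : ∀ j, (1 - c) * v j ≤ 1 := by
    have := maxprin c hc0 hc1 E hE (fun j => 1 - (1 - c) * v j) (by
      intro j
      have hpos : (0 : ℝ) < (outS E j).card := by exact_mod_cast hE j
      have h := hv j
      rw [Pmul] at h ⊢
      rw [Finset.sum_sub_distrib, ← Finset.mul_sum]
      simp only [Finset.sum_const, nsmul_eq_mul, mul_one]
      rw [mul_sub, inv_mul_cancel₀ hpos.ne']
      have : ind I j ≤ 1 := by unfold ind; split_ifs <;> norm_num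
      set X := ∑ i ∈ outS E j, v i
      have e : ((outS E j).card : ℝ)⁻¹ * ((1 - c) * X) = (1 - c) * (((outS E j).card : ℝ)⁻¹ * X) := by ring
      rw [e, h]
      nlinarith)
    intro j
    have := this j
    try simp only at this
    linarith
  obtain ⟨j, hj, hp⟩ := hA.2 i hi
  clear hi
  induction hp using Relation.ReflTransGen.head_induction_on with
  | refl =>
    have h := hv j
    have h2 := hPle j hb
    have h3 : ind I j = 0 := by simp at hj; simp [ind, hj]
    rw [h, h3]; nlinarith
  | @head x y hxy _ ih =>
    have hpos : (0 : ℝ) < (outS E x).card := by exact_mod_cast hE x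
    have : (1 - c) * (Pmat E *ᵥ v) x < 1 := by
      rw [Pmul]
      have := Finset.sum_lt_sum (s := outS E x) (f := fun j => (1 - c) * v j) (g := fun _ => (1:ℝ))
        (fun x _ => hb x) ⟨y, mem_outS.2 hxy, ih⟩
      rw [← Finset.mul_sum] at this
      simp at this
      rw [mul_left_comm, inv_mul_lt_iff₀ hpos]
      linarith
    have h := hv x
    have h3 : ind I x ≤ 1 := by unfold ind; split_ifs <;> norm_num
    rw [h]; nlinarith

/-- access to the complement of `I` without using outlinks of `i` -/
def Tacc {n : ℕ} (E : Finset (Fin n × Fin n)) (I : Finset (Fin n)) (i t : Fin n) : Prop :=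
  ∃ j, j ∉ I ∧ Relation.ReflTransGen (fun a b => (a, b) ∈ E ∧ a ≠ i) t j

lemma Tacc_base {n : ℕ} {E : Finset (Fin n × Fin n)} {I : Finset (Fin n)} {i t : Fin n}
    (h : t ∉ I) : Tacc E I i t := ⟨t, h, .refl⟩

lemma Tacc_step {n : ℕ} {E : Finset (Fin n × Fin n)} {I : Finset (Fin n)} {i t s : Fin n}
    (hts : (t, s) ∈ E) (hne : t ≠ i) (h : Tacc E I i s) : Tacc E I i t := by
  obtain ⟨j, hj, hp⟩ := h
  exact ⟨j, hj, .head ⟨hts, hne⟩ hp⟩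

lemma Tacc_self {n : ℕ} {E : Finset (Fin n × Fin n)} {I : Finset (Fin n)} {i : Fin n}
    (hi : i ∈ I) : ¬ Tacc E I i i := by
  rintro ⟨j, hj, hp⟩
  rcases Relation.ReflTransGen.cases_head hp with h | ⟨y, h, _⟩
  · exact hj (h ▸ hi)
  · exact h.2 rfl

lemma Tacc_out {n : ℕ} {E : Finset (Fin n × Fin n)} {I : Finset (Fin n)} {i : Fin n}
    (hi : i ∈ I) (hacc : access E i Iᶜ) : ∃ t ∈ outS E i, Tacc E I i t := by
  obtain ⟨j, hj, hp⟩ := hacc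
  have hj' : j ∉ I := by simpa using hj
  have key : ∀ x, Relation.ReflTransGen (fun a b => (a, b) ∈ E) x j →
      Tacc E I i x ∨ ∃ t ∈ outS E i, Tacc E I i t := by
    intro x hx
    induction hx using Relation.ReflTransGen.head_induction_on with
    | refl => exact .inl (Tacc_base hj')
    | @head x y hxy _ ih =>
      rcases ih with ih | ih
      · by_cases h : x = i
        · subst h; exact .inr ⟨y, mem_outS.2 hxy, ih⟩
        · exact .inl (Tacc_step hxy h ih)
      · exact .inr ih
  exact (key i hp).resolve_left (Tacc_self hi)

lemma Tacc_total {n : ℕ} {E : Finset (Fin n × Fin n)} {I : Finset (Fin n)} {i k : Fin n}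
    (hi : i ∈ I) (hne : i ≠ k) (hacc : access E i Iᶜ) : Tacc E I i k ∨ Tacc E I k i := by
  obtain ⟨j, hj, hp⟩ := hacc
  have hj' : j ∉ I := by simpa using hj
  have key : ∀ x, Relation.ReflTransGen (fun a b => (a, b) ∈ E) x j →
      (Tacc E I i x ∧ Tacc E I k x) ∨ (Tacc E I i k ∨ Tacc E I k i) := by
    intro x hx
    induction hx using Relation.ReflTransGen.head_induction_on with
    | refl => exact .inl ⟨Tacc_base hj', Tacc_base hj'⟩
    | @head x y hxy _ ih =>
      rcases ih with ih | ih
      · by_cases h : x = i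
        · subst h; exact .inr (.inr (Tacc_step hxy hne ih.2))
        · by_cases h' : x = k
          · subst h'; exact .inr (.inl (Tacc_step hxy h ih.1))
          · exact .inl ⟨Tacc_step hxy h ih.1, Tacc_step hxy h' ih.2⟩
      · exact .inr ih
  exact (key i hp).resolve_left (fun h => Tacc_self hi h.1)

/-- Combinatorial core. -/
lemma core_s17 {n : ℕ} (E : Finset (Fin n × Fin n)) (I : Finset (Fin n)) (hI2 : 2 ≤ I.card)
    (v a : Fin n → ℝ)
    (h1 : ∀ i ∈ I, i ∉ outS E i)
    (h2 : ∀ i ∈ I, ∑ s ∈ outS E i, (v s - a i) = 0)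
    (h3 : ∀ i ∈ I, a i < v i)
    (h4 : ∀ i ∈ I, ∀ S : Finset (Fin n), i ∉ S → (∃ t ∈ S, Tacc E I i t) →
      ∑ s ∈ S, (v s - a i) ≤ 0)
    (h5 : ∀ i ∈ I, access E i Iᶜ) :
    (∀ i ∈ I, ∀ j ∈ I, v i = v j → i = j) ∧
    (∀ i ∈ I, ∀ j, j ∉ I → v j < v i) ∧
    (∀ i ∈ I, ∀ j ∈ I, v i < v j → (i, j) ∈ E) ∧
    (∀ i ∈ I, ∃ t, (i, t) ∈ E ∧ v t < v i) ∧
    (∀ i ∈ I, ∀ j, (i, j) ∈ E → ∀ k ∈ I, v j < v k → v k < v i → False) ∧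
    (∃ i ∈ I, ∃ t, t ∉ I ∧ (∀ j ∈ I, v i ≤ v j) ∧ (i, t) ∈ E ∧
      (∀ t', t' ∉ I → (i, t') ∈ E → t' = t) ∧ (∀ t', t' ∉ I → v t' ≤ v t)) := by
  have h7 : ∀ i ∈ I, ∀ x, x ≠ i → x ∉ outS E i → v x ≤ a i := by
    intro i hi x hx hxo
    obtain ⟨t, ht, hT⟩ := Tacc_out hi (h5 i hi)
    have := h4 i hi (insert x (outS E i)) (by
      simp only [Finset.mem_insert, not_or]; exact ⟨hx.symm, h1 i hi⟩)
      ⟨t, Finset.mem_insert_of_mem ht, hT⟩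
    rw [Finset.sum_insert hxo, h2 i hi] at this
    linarith
  have h8 : ∀ i ∈ I, ∀ t, Tacc E I i t → v t ≤ a i := by
    intro i hi t hT
    have hne : i ≠ t := by rintro rfl; exact Tacc_self hi hT
    have := h4 i hi {t} (by simpa using hne) ⟨t, by simp, hT⟩
    simpa using this
  have h8' : ∀ i ∈ I, ∀ t, Tacc E I i t → v t < v i := fun i hi t hT =>
    (h8 i hi t hT).trans_lt (h3 i hi)
  have h10 : ∀ i ∈ I, ∀ j ∈ I, v j < v i → Tacc E I i j := by
    intro i hi j hj hlt
    have hne : i ≠ j := by rintro rfl; exact lt_irrefl _ hlt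
    rcases Tacc_total hi hne (h5 i hi) with h | h
    · exact h
    · exact absurd (h8' j hj i h) (by linarith)
  have hinj : ∀ i ∈ I, ∀ j ∈ I, v i = v j → i = j := by
    intro i hi j hj he
    by_contra hne
    rcases Tacc_total hi hne (h5 i hi) with h | h
    · have := h8' i hi j h; linarith
    · have := h8' j hj i h; linarith
  have h9 : ∀ i ∈ I, ∀ j, j ∉ I → v j < v i := fun i hi j hj => h8' i hi j (Tacc_base hj)
  have h11 : ∀ i ∈ I, ∀ j ∈ I, v i < v j → (i, j) ∈ E := by
    intro i hi j hj hlt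
    by_contra hE
    have := h7 i hi j (by rintro rfl; exact lt_irrefl _ hlt) (by rwa [mem_outS])
    have := h3 i hi
    linarith
  have hex : ∀ i ∈ I, ∃ t, (i, t) ∈ E ∧ v t < v i := by
    intro i hi
    obtain ⟨t, ht, hT⟩ := Tacc_out hi (h5 i hi)
    exact ⟨t, mem_outS.1 ht, h8' i hi t hT⟩
  refine ⟨hinj, h9, h11, hex, ?_, ?_⟩
  · intro i hi j hij k hk hjk hki
    have hT : Tacc E I k j := by
      by_cases hj : j ∈ I
      · exact h10 k hk j hj hjk
      · exact Tacc_base hj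
    have hne : i ≠ k := by rintro rfl; exact lt_irrefl _ hki
    have := h8' k hk i (Tacc_step hij hne hT)
    linarith
  · obtain ⟨i, hi, hmin⟩ := Finset.exists_min_image I v (Finset.card_pos.1 (by omega))
    obtain ⟨t, hit, hlt⟩ := hex i hi
    have ht : t ∉ I := fun h => absurd (hmin t h) (by linarith)
    obtain ⟨j, hj, hji⟩ := Finset.exists_mem_ne (by omega : 1 < I.card) i
    have hvj : v i < v j := lt_of_le_of_ne (hmin j hj) (fun h => hji (hinj i hi j hj h).symm)
    have huniq : ∀ t', t' ∉ I → (i, t') ∈ E → t' = t := by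
      intro t' ht' hit'
      by_contra hne
      have e1 := h4 i hi ((outS E i).erase t') (fun h => h1 i hi (Finset.mem_of_mem_erase h))
        ⟨t, Finset.mem_erase.2 ⟨Ne.symm hne, mem_outS.2 hit⟩, Tacc_base ht⟩
      have e2 := Finset.add_sum_erase (outS E i) (fun s => v s - a i) (mem_outS.2 hit')
      rw [h2 i hi] at e2
      have e3 := h4 i hi {t', j} (by
        simp only [Finset.mem_insert, Finset.mem_singleton, not_or]
        exact ⟨by rintro rfl; exact ht' hi, hji.symm⟩) ⟨t', by simp, Tacc_base ht'⟩
      rw [Finset.sum_pair (by rintro rfl; exact ht' hj)] at e3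
      have := h3 i hi
      try simp only at e2
      linarith
    refine ⟨i, hi, t, ht, hmin, hit, huniq, ?_⟩
    intro t' ht'
    by_contra hlt'
    push Not at hlt'
    have hnot : t' ∉ outS E i := by
      intro h
      have := huniq t' ht' (mem_outS.1 h)
      subst this; exact lt_irrefl _ hlt'
    have e2 := Finset.add_sum_erase (outS E i) (fun s => v s - a i) (mem_outS.2 hit)
    have e1 := h4 i hi (insert t' ((outS E i).erase t)) (by
      simp only [Finset.mem_insert, not_or]
      exact ⟨by rintro rfl; exact ht' hi, fun h => h1 i hi (Finset.mem_of_mem_erase h)⟩)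
      ⟨t', by simp, Tacc_base ht'⟩
    rw [Finset.sum_insert (fun h => hnot (Finset.mem_of_mem_erase h))] at e1
    rw [h2 i hi] at e2
    try simp only at e2
    linarith

lemma lower_mem {n : ℕ} (s : Finset (Fin n)) (hs : ∀ k l : Fin n, k ≤ l → l ∈ s → k ∈ s)
    (k : Fin n) : k ∈ s ↔ (k : ℕ) < s.card := by
  constructor
  · intro hk
    have := Finset.card_le_card (s := Finset.Iic k) (t := s)
      (fun x hx => hs x k (Finset.mem_Iic.1 hx) hk)
    rw [Fin.card_Iic] at this
    omega
  · intro h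
    by_contra hk
    have := Finset.card_le_card (s := s) (t := Finset.Iio k) (fun x hx => by
      rw [Finset.mem_Iio]
      by_contra hlt
      exact hk (hs k x (not_lt.1 hlt) hx))
    rw [Fin.card_Iio] at this
    omega

/-- the node ordering -/
lemma sort_nodes {n : ℕ} (I : Finset (Fin n)) (v : Fin n → ℝ) (t : Fin n) (ht : t ∉ I)
    (h9 : ∀ i ∈ I, ∀ j, j ∉ I → v j < v i) (hmax : ∀ t', t' ∉ I → v t' ≤ v t) :
    ∃ φ : Fin n ≃ Fin n, (∀ k : Fin n, φ k ∈ I ↔ (k : ℕ) < I.card) ∧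
      (∀ k l : Fin n, k ≤ l → v (φ l) ≤ v (φ k)) ∧
      (∃ l : Fin n, (l : ℕ) = I.card ∧ φ l = t) := by
  let f : Fin n → ℝ ×ₗ ℕ := fun x => toLex (-v x, if x = t then 0 else 1)
  let φ := Tuple.sort f
  have hm : ∀ k l, k ≤ l → f (φ k) ≤ f (φ l) := fun k l h => Tuple.monotone_sort f h
  have hanti : ∀ k l : Fin n, k ≤ l → v (φ l) ≤ v (φ k) := by
    intro k l h
    have := hm k l h
    simp only [f, Prod.Lex.toLex_le_toLex] at this
    rcases this with h | h
    · linarith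
    · linarith [h.1]
  have hcard : ∀ k : Fin n, φ k ∈ I ↔ (k : ℕ) < I.card := by
    intro k
    have hc : (Finset.univ.filter (fun k => φ k ∈ I)).card = I.card := by
      apply Finset.card_bij (fun k _ => φ k)
      · intro a ha; simpa using ha
      · intro a _ b _ h; exact φ.injective h
      · intro b hb; exact ⟨φ.symm b, by simpa using hb, by simp⟩
    rw [← hc, ← lower_mem]
    · simp
    · intro k l hkl hl
      simp at hl ⊢
      by_contra hk
      have := h9 _ hl _ hk
      have := hanti k l hkl
      linarith
  refine ⟨φ, hcard, hanti, ?_⟩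
  have hr : ¬ ((φ.symm t : Fin n) : ℕ) < I.card := by
    rw [← hcard]; simpa using ht
  have hlt : I.card < n := lt_of_le_of_lt (not_lt.1 hr) (φ.symm t).2
  refine ⟨⟨I.card, hlt⟩, rfl, ?_⟩
  have hnot : φ ⟨I.card, hlt⟩ ∉ I := by rw [hcard]; simp
  have h1 := hm ⟨I.card, hlt⟩ (φ.symm t) (by rw [Fin.le_def]; simpa using hr)
  simp only [f, Prod.Lex.toLex_le_toLex, Equiv.apply_symm_apply] at h1
  have h2 := hmax _ hnot
  rcases h1 with h | h
  · linarith
  · by_contra hne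
    simp [hne] at h

/-- Corollary 16 (Optimal link structure with no self-links): for `|I| ≥ 2`, every pair
`(H, F)` maximizing the PageRank of `I` among admissible pairs with no self-links admits
a relabeling of the nodes under which `I = {1,…,n_I}`,
`v₁ > … > v_{n_I} > v_{n_I+1} ≥ … ≥ v_n`,
`H = {(i,j) ∈ I×I : j < i or j = i+1}` and `F = {(n_I, n_I+1)}`. -/
theorem stmt17 {n : ℕ} (hn : 1 ≤ n) (c : ℝ) (hc0 : 0 < c) (hc1 : c < 1)
    (z : Fin n → ℝ) (hz : ∀ i, 0 < z i) (hz1 : ∑ i, z i = 1)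
    (I : Finset (Fin n)) (hI2 : 2 ≤ I.card) (hIc : (Iᶜ : Finset (Fin n)).Nonempty)
    (Ein Eext : Finset (Fin n × Fin n))
    (hEin : ∀ p ∈ Ein, p.1 ∉ I ∧ p.2 ∈ I)
    (hEext : ∀ p ∈ Eext, p.1 ∉ I ∧ p.2 ∉ I)
    (hout : ∀ i, i ∉ I → ∃ j, (i, j) ∈ Ein ∪ Eext)
    (H F : Finset (Fin n × Fin n))
    (hH : ∀ p ∈ H, p.1 ∈ I ∧ p.2 ∈ I) (hHs : ∀ i : Fin n, (i, i) ∉ H)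
    (hF : ∀ p ∈ F, p.1 ∈ I ∧ p.2 ∉ I)
    (hAdm : admissible (H ∪ F ∪ Ein ∪ Eext) I)
    (hOpt : ∀ H' F' : Finset (Fin n × Fin n),
      (∀ p ∈ H', p.1 ∈ I ∧ p.2 ∈ I) → (∀ i : Fin n, (i, i) ∉ H') →
      (∀ p ∈ F', p.1 ∈ I ∧ p.2 ∉ I) →
      admissible (H' ∪ F' ∪ Ein ∪ Eext) I →
      prSet c z (H' ∪ F' ∪ Ein ∪ Eext) I ≤ prSet c z (H ∪ F ∪ Ein ∪ Eext) I) :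
    ∃ φ : Fin n ≃ Fin n,
      (∀ k : Fin n, φ k ∈ I ↔ (k : ℕ) < I.card) ∧
      (∀ k : Fin n, ∀ hk : (k : ℕ) + 1 < n,
        ((k : ℕ) + 1 ≤ I.card →
          vvec c (H ∪ F ∪ Ein ∪ Eext) I (φ ⟨(k : ℕ) + 1, hk⟩) <
            vvec c (H ∪ F ∪ Ein ∪ Eext) I (φ k)) ∧
        vvec c (H ∪ F ∪ Ein ∪ Eext) I (φ ⟨(k : ℕ) + 1, hk⟩) ≤
          vvec c (H ∪ F ∪ Ein ∪ Eext) I (φ k)) ∧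
      (∀ a b : Fin n, ((a, b) ∈ H ↔ ∃ k l : Fin n,
        (k : ℕ) < I.card ∧ (l : ℕ) < I.card ∧ a = φ k ∧ b = φ l ∧
          ((l : ℕ) < (k : ℕ) ∨ (l : ℕ) = (k : ℕ) + 1))) ∧
      (∃ k l : Fin n, (k : ℕ) = I.card - 1 ∧ (l : ℕ) = I.card ∧
        F = {(φ k, φ l)}) := by
  set E := H ∪ F ∪ Ein ∪ Eext with hEdef
  have hEH : ∀ a b, a ∈ I → b ∈ I → ((a, b) ∈ E ↔ (a, b) ∈ H) := by
    intro a b ha hb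
    have := hF (a, b); have := hEin (a, b); have := hEext (a, b)
    simp only [hEdef, Finset.mem_union]
    tauto
  have hEF : ∀ a b, a ∈ I → b ∉ I → ((a, b) ∈ E ↔ (a, b) ∈ F) := by
    intro a b ha hb
    have := hH (a, b); have := hEin (a, b); have := hEext (a, b)
    simp only [hEdef, Finset.mem_union]
    tauto
  have hv := v_eq c hc0 hc1 E hAdm.1 I
  have hvlt := v_lt c hc0 hc1 E I hAdm
  have himp := improve_s17 c hc0 hc1 z hz I E
  set v := vvec c E I with hvdef
  have hcard : ∀ i, (0 : ℝ) < (outS E i).card := fun i => by exact_mod_cast hAdm.1 i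
  let a : Fin n → ℝ := fun i => (Pmat E *ᵥ v) i
  have hav : ∀ i ∈ I, v i = 1 + c * a i := by
    intro i hi
    have := hv i
    simpa [ind, hi] using this
  have hcore := core_s17 E I hI2 v a
    (by
      intro i hi h
      rw [mem_outS, hEH i i hi hi] at h
      exact hHs i h)
    (by
      intro i hi
      rw [Finset.sum_sub_distrib]
      simp only [a, Pmul, Finset.sum_const, nsmul_eq_mul]
      rw [mul_inv_cancel_left₀ (hcard i).ne', sub_self])
    (by
      intro i hi
      have h1 := hav i hi
      have h2 := hvlt i hi
      nlinarith)
    (by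
      intro i hi S hiS hT
      obtain ⟨t, htS, hT⟩ := hT
      by_contra hpos
      push Not at hpos
      let H' := H.filter (fun p => p.1 ≠ i) ∪ (S.filter (· ∈ I)).image (fun s => (i, s))
      let F' := F.filter (fun p => p.1 ≠ i) ∪ (S.filter (· ∉ I)).image (fun s => (i, s))
      have hmem1 : ∀ b, (i, b) ∈ H' ∪ F' ∪ Ein ∪ Eext ↔ b ∈ S := by
        intro b
        have := hEin (i, b); have := hEext (i, b)
        simp only [H', F', Finset.mem_union, Finset.mem_filter, Finset.mem_image, Prod.mk.injEq,
          true_and, exists_eq_right]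
        tauto
      have hmem2 : ∀ x b, x ≠ i → ((x, b) ∈ H' ∪ F' ∪ Ein ∪ Eext ↔ (x, b) ∈ E) := by
        intro x b hx
        simp only [H', F', hEdef, Finset.mem_union, Finset.mem_filter, Finset.mem_image,
          Prod.mk.injEq, hx.symm, false_and, and_false, exists_false]
        tauto
      have ho1 : outS (H' ∪ F' ∪ Ein ∪ Eext) i = S := by
        ext b; rw [mem_outS, hmem1]
      have ho2 : ∀ x, x ≠ i → outS (H' ∪ F' ∪ Ein ∪ Eext) x = outS E x := by
        intro x hx; ext b; rw [mem_outS, mem_outS, hmem2 x b hx]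
      have hA' : admissible (H' ∪ F' ∪ Ein ∪ Eext) I := by
        constructor
        · intro x
          rw [outdeg_eq]
          by_cases hx : x = i
          · subst hx; rw [ho1]; exact Finset.card_pos.2 ⟨t, htS⟩
          · rw [ho2 x hx]; exact hAdm.1 x
        · intro x hx
          obtain ⟨j, hj, hp⟩ := hAdm.2 x hx
          clear hx
          induction hp using Relation.ReflTransGen.head_induction_on with
          | refl => exact ⟨j, hj, .refl⟩
          | @head x y hxy _ ih =>
            by_cases hx : x = i
            · subst hx
              obtain ⟨j', hj', hp'⟩ := hT
              refine ⟨j', by simpa using hj', .head ((hmem1 t).2 htS) ?_⟩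
              exact Relation.ReflTransGen.mono (fun p q h => (hmem2 p q h.2).2 h.1) _ _ hp'
            · obtain ⟨j', hj', hp'⟩ := ih
              exact ⟨j', hj', .head ((hmem2 x y hx).2 hxy) hp'⟩
      have hle := hOpt H' F'
        (by
          intro p hp
          simp only [H', Finset.mem_union, Finset.mem_filter, Finset.mem_image] at hp
          rcases hp with hp | ⟨s, hs, rfl⟩
          · exact hH p hp.1
          · exact ⟨hi, hs.2⟩)
        (by
          intro x hx
          simp only [H', Finset.mem_union, Finset.mem_filter, Finset.mem_image,
            Prod.mk.injEq] at hx
          rcases hx with hp | ⟨s, hs, rfl, rfl⟩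
          · exact hHs x hp.1
          · exact hiS hs.1)
        (by
          intro p hp
          simp only [F', Finset.mem_union, Finset.mem_filter, Finset.mem_image] at hp
          rcases hp with hp | ⟨s, hs, rfl⟩
          · exact hF p hp.1
          · exact ⟨hi, hs.2⟩)
        hA'
      have hlti : v i < ind I i + c * (Pmat (H' ∪ F' ∪ Ein ∪ Eext) *ᵥ v) i := by
        have hS : (0 : ℝ) < S.card := by exact_mod_cast Finset.card_pos.2 ⟨t, htS⟩
        have : a i < (Pmat (H' ∪ F' ∪ Ein ∪ Eext) *ᵥ v) i := by
          rw [Pmul, ho1, lt_inv_mul_iff₀ hS]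
          rw [Finset.sum_sub_distrib] at hpos
          simp only [Finset.sum_const, nsmul_eq_mul] at hpos
          linarith
        rw [hav i hi]
        simp only [ind, hi, if_true]
        nlinarith
      have := himp (H' ∪ F' ∪ Ein ∪ Eext) hA'.1 (by
        intro x
        by_cases hx : x = i
        · subst hx; exact hlti.le
        · rw [Pmul, ho2 x hx, ← Pmul]; exact (hv x).le) i hlti
      linarith)
    hAdm.2
  obtain ⟨hinj, h9, h11, hex, hbtw, i, hi, t, ht, hmin, hit, huniq, hmax⟩ := hcore
  obtain ⟨φ, hφI, hanti, l₀, hl₀, hl₀t⟩ := sort_nodes I v t ht h9 hmax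
  have hstrict : ∀ k l : Fin n, k < l → (k : ℕ) < I.card → v (φ l) < v (φ k) := by
    intro k l hkl hk
    by_cases hl : φ l ∈ I
    · refine lt_of_le_of_ne (hanti k l hkl.le) (fun h => ?_)
      exact hkl.ne' (φ.injective (hinj _ hl _ ((hφI k).2 hk) h))
    · exact h9 _ ((hφI k).2 hk) _ hl
  have hfwd : ∀ k l : Fin n, (k : ℕ) < I.card → (φ k, φ l) ∈ E → (k : ℕ) + 1 < I.card →
      (l : ℕ) ≤ (k : ℕ) + 1 := by
    intro k l hk hE hk1
    by_contra hlt
    have hk1n : (k : ℕ) + 1 < n := by have := l.2; omega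
    refine hbtw _ ((hφI k).2 hk) _ hE (φ ⟨(k : ℕ) + 1, hk1n⟩) ((hφI _).2 hk1) ?_ ?_
    · exact hstrict _ _ (by rw [Fin.lt_def]; simp only; omega) hk1
    · exact hstrict _ _ (by rw [Fin.lt_def]; simp only; omega) hk
  have hlast : ∃ k₀ : Fin n, (k₀ : ℕ) = I.card - 1 ∧ φ k₀ = i := by
    have hlt : ((φ.symm i : Fin n) : ℕ) < I.card := by rw [← hφI]; simpa using hi
    refine ⟨φ.symm i, ?_, by simp⟩
    by_contra hne
    have hn' : ((φ.symm i : Fin n) : ℕ) + 1 < n := by have := l₀.2; omega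
    have h1 : ((φ.symm i : Fin n) : ℕ) + 1 < I.card := by omega
    have := hstrict (φ.symm i) ⟨_, hn'⟩ (by rw [Fin.lt_def]; simp only; omega) hlt
    have h2 := hmin (φ ⟨_, hn'⟩) ((hφI _).2 h1)
    simp only [Equiv.apply_symm_apply] at this
    linarith
  obtain ⟨k₀, hk₀, hk₀i⟩ := hlast
  refine ⟨φ, hφI, ?_, ?_, k₀, l₀, hk₀, hl₀, ?_⟩
  · intro k hk
    refine ⟨fun h => hstrict _ _ (by rw [Fin.lt_def]; simp only; omega) (by omega), ?_⟩
    exact hanti _ _ (by rw [Fin.le_def]; simp only; omega)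
  · intro x y
    constructor
    · intro hxy
      obtain ⟨hx, hy⟩ := hH _ hxy
      simp only at hx hy
      have hk : ((φ.symm x : Fin n) : ℕ) < I.card := by rw [← hφI]; simpa using hx
      have hl : ((φ.symm y : Fin n) : ℕ) < I.card := by rw [← hφI]; simpa using hy
      refine ⟨φ.symm x, φ.symm y, hk, hl, by simp, by simp, ?_⟩
      have hne : ((φ.symm x : Fin n) : ℕ) ≠ (φ.symm y : Fin n) := by
        intro h
        have := φ.symm.injective (Fin.ext h)
        subst this
        exact hHs _ hxy
      by_contra hcon
      push Not at hcon
      have := hfwd (φ.symm x) (φ.symm y) hk (by simpa using (hEH x y hx hy).2 hxy) (by omega)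
      omega
    · rintro ⟨k, l, hk, hl, rfl, rfl, h⟩
      have hkI := (hφI k).2 hk
      have hlI := (hφI l).2 hl
      rw [← hEH _ _ hkI hlI]
      rcases h with h | h
      · exact h11 _ hkI _ hlI (hstrict l k h hl)
      · obtain ⟨s, hs, hvs⟩ := hex _ hkI
        have h1 := hfwd k (φ.symm s) hk (by simpa using hs) (by omega)
        have h2 : k < φ.symm s := by
          by_contra hle
          have := hanti _ _ (not_lt.1 hle)
          simp only [Equiv.apply_symm_apply] at this
          linarith
        have h3 : φ.symm s = l := by
          apply Fin.ext
          rw [Fin.lt_def] at h2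
          omega
        rw [← h3]; simpa using hs
  · rw [hk₀i, hl₀t]
    ext ⟨x, y⟩
    rw [Finset.mem_singleton]
    constructor
    · intro hxy
      obtain ⟨hx, hy⟩ := hF _ hxy
      simp only at hx hy
      have hE := (hEF x y hx hy).2 hxy
      have hk : ((φ.symm x : Fin n) : ℕ) < I.card := by rw [← hφI]; simpa using hx
      have hl : ¬ ((φ.symm y : Fin n) : ℕ) < I.card := by rw [← hφI]; simpa using hy
      have hxk : φ.symm x = k₀ := by
        apply Fin.ext
        by_contra hne
        have := hfwd (φ.symm x) (φ.symm y) hk (by simpa using hE) (by omega)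
        omega
      have hxi : x = i := by rw [← hk₀i, ← hxk]; simp
      subst hxi
      rw [huniq y hy hE]
    · intro h
      rw [h, ← hEF i t hi ht]
      exact hit
end

section
/- Optimal link structure for a single node with no self-link: let I = {i} be a singleton with Ī nonempty, fix E_in(I) and E_Ī such that every node of Ī has at least one outlink in E_in(I) ∪ E_Ī, require the internal link set to be empty (H = ∅), and let V_0 = {j ∈ Ī : (v_0)_j = max_{k ∈ Ī} (v_0)_k}, where v_0 is computed in the basic absorbing graph. Then an admissible outlink set F ⊆ {i} × Ī maximizes the PageRank π_i (among admissible outlink sets, with H = ∅) if and only if F is nonempty and F ⊆ {(i,j) : j ∈ V_0}. -/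
open Matrix Finset

lemma aux_row {n : ℕ} (E : Finset (Fin n × Fin n)) (k : Fin n) (w : Fin n → ℝ) :
    (Pmat E *ᵥ w) k =
      ((outdeg E k : ℝ))⁻¹ * ∑ j ∈ Finset.univ.filter (fun j => (k, j) ∈ E), w j := by
  rw [Finset.mul_sum, Finset.sum_filter]
  simp [Matrix.mulVec, dotProduct, Pmat, ite_mul]

lemma aux_nonneg {n : ℕ} (E : Finset (Fin n × Fin n)) (k j : Fin n) : 0 ≤ Pmat E k j := by
  unfold Pmat
  split_ifs <;> positivity

lemma aux_sum {n : ℕ} (E : Finset (Fin n × Fin n)) (h : ∀ k, 0 < outdeg E k) (k : Fin n) :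
    ∑ j, Pmat E k j = 1 := by
  have h1 := aux_row E k (fun _ => 1)
  have h2 : (Pmat E *ᵥ (fun _ => (1 : ℝ))) k = ∑ j, Pmat E k j := by
    simp [Matrix.mulVec, dotProduct]
  rw [← h2, h1]
  have h3 : (outdeg E k : ℝ) ≠ 0 := by
    have := h k
    positivity
  rw [Finset.sum_const, nsmul_eq_mul, mul_one]
  exact inv_mul_cancel₀ h3

lemma aux_unit {n : ℕ} (E : Finset (Fin n × Fin n)) (h : ∀ k, 0 < outdeg E k) (c : ℝ)
    (hc0 : 0 < c) (hc1 : c < 1) : IsUnit (1 - c • Pmat E).det := by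
  rw [isUnit_iff_ne_zero]
  apply det_ne_zero_of_sum_row_lt_diag
  intro k
  have hs := aux_sum E h k
  rw [← Finset.add_sum_erase _ _ (Finset.mem_univ k)] at hs
  have hk := aux_nonneg E k k
  have hrest : 0 ≤ ∑ j ∈ Finset.univ.erase k, Pmat E k j :=
    Finset.sum_nonneg fun j _ => aux_nonneg E k j
  have h1 : ∑ j ∈ Finset.univ.erase k, ‖(1 - c • Pmat E) k j‖
      = c * ∑ j ∈ Finset.univ.erase k, Pmat E k j := by
    rw [Finset.mul_sum]
    refine Finset.sum_congr rfl fun j hj => ?_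
    have hne : k ≠ j := (Finset.ne_of_mem_erase hj).symm
    have := aux_nonneg E k j
    simp [Matrix.sub_apply, Matrix.one_apply_ne hne, abs_of_nonneg this, abs_of_pos hc0]
  have h2 : ‖(1 - c • Pmat E) k k‖ = 1 - c * Pmat E k k := by
    rw [Real.norm_of_nonneg]
    · simp
    · simp only [Matrix.sub_apply, Matrix.one_apply_eq, Matrix.smul_apply, smul_eq_mul]
      nlinarith
  rw [h1, h2]
  nlinarith

/-- `v` solves the linear system and is the unique solution. -/
lemma aux_solve {n : ℕ} (E : Finset (Fin n × Fin n)) (h : ∀ k, 0 < outdeg E k) (c : ℝ)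
    (hc0 : 0 < c) (hc1 : c < 1) (I : Finset (Fin n)) (w : Fin n → ℝ) :
    w = vvec c E I ↔ ∀ k, w k = ind I k + c * (Pmat E *ᵥ w) k := by
  have hu := aux_unit E h c hc0 hc1
  have key : w = vvec c E I ↔ (1 - c • Pmat E) *ᵥ w = ind I := by
    constructor
    · rintro rfl
      rw [vvec, Matrix.mulVec_mulVec, Matrix.mul_nonsing_inv _ hu, Matrix.one_mulVec]
    · intro hw
      rw [vvec, ← hw, Matrix.mulVec_mulVec, Matrix.nonsing_inv_mul _ hu, Matrix.one_mulVec]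
  rw [key, funext_iff]
  refine forall_congr' fun k => ?_
  simp only [Matrix.sub_mulVec, Matrix.one_mulVec, Matrix.smul_mulVec, Pi.sub_apply,
    Pi.smul_apply, smul_eq_mul]
  exact sub_eq_iff_eq_add

lemma aux_pr {n : ℕ} (c : ℝ) (z : Fin n → ℝ) (E : Finset (Fin n × Fin n)) (i : Fin n) :
    prSet c z E {i} = (1 - c) * ∑ j, z j * vvec c E {i} j := by
  simp only [prSet, pr, vvec, Finset.sum_singleton, Pi.smul_apply, smul_eq_mul]
  congr 1
  simp only [Matrix.mulVec, dotProduct, Matrix.transpose_apply, ind, Finset.mem_singleton]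
  simp [mul_comm]

lemma aux_bounds {n : ℕ} (E : Finset (Fin n × Fin n)) (h : ∀ k, 0 < outdeg E k) (c : ℝ)
    (hc0 : 0 < c) (hc1 : c < 1) (I : Finset (Fin n)) (k : Fin n) :
    0 ≤ vvec c E I k ∧ vvec c E I k ≤ 1 / (1 - c) := by
  have hs := (aux_solve E h c hc0 hc1 I (vvec c E I)).1 rfl
  set u := vvec c E I
  have hne : (Finset.univ : Finset (Fin n)).Nonempty := ⟨k, Finset.mem_univ k⟩
  have hi0 : ∀ l, 0 ≤ ind I l ∧ ind I l ≤ 1 := by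
    intro l
    unfold ind
    split_ifs <;> norm_num
  constructor
  · obtain ⟨m, -, hm⟩ := Finset.exists_min_image Finset.univ u hne
    have h1 : u m ≤ (Pmat E *ᵥ u) m := by
      calc u m = ∑ j, Pmat E m j * u m := by rw [← Finset.sum_mul, aux_sum E h, one_mul]
        _ ≤ _ := Finset.sum_le_sum fun j _ =>
          mul_le_mul_of_nonneg_left (hm j (Finset.mem_univ j)) (aux_nonneg E m j)
    have h2 := hs m
    have h3 := hi0 m
    have h4 := hm k (Finset.mem_univ k)
    nlinarith
  · obtain ⟨m, -, hm⟩ := Finset.exists_max_image Finset.univ u hne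
    have h1 : (Pmat E *ᵥ u) m ≤ u m := by
      calc (Pmat E *ᵥ u) m = ∑ j, Pmat E m j * u j := rfl
        _ ≤ ∑ j, Pmat E m j * u m := Finset.sum_le_sum fun j _ =>
            mul_le_mul_of_nonneg_left (hm j (Finset.mem_univ j)) (aux_nonneg E m j)
        _ = u m := by rw [← Finset.sum_mul, aux_sum E h, one_mul]
    have h2 := hs m
    have h3 := hi0 m
    have h4 := hm k (Finset.mem_univ k)
    rw [le_div_iff₀ (by linarith)]
    nlinarith

/-- The PageRank formula in terms of `v₀`. -/
lemma aux_formula {n : ℕ} (c : ℝ) (hc0 : 0 < c) (hc1 : c < 1) (z : Fin n → ℝ) (i : Fin n)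
    (E E0 : Finset (Fin n × Fin n)) (h : ∀ k, 0 < outdeg E k) (h0 : ∀ k, 0 < outdeg E0 k)
    (hii : ∀ j, (i, j) ∈ E0 ↔ j = i)
    (hsame : ∀ k, k ≠ i → ∀ j, (k, j) ∈ E ↔ (k, j) ∈ E0) :
    0 < 1 / (1 - c) - c * (Pmat E *ᵥ vvec c E0 {i}) i ∧ vvec c E0 {i} i = 1 / (1 - c) ∧
    prSet c z E {i} = (1 - c) * (∑ j, z j * vvec c E0 {i} j) /
      (1 / (1 - c) - c * (Pmat E *ᵥ vvec c E0 {i}) i) := by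
  have hs := (aux_solve E0 h0 c hc0 hc1 {i} (vvec c E0 {i})).1 rfl
  have hb := aux_bounds E0 h0 c hc0 hc1 {i}
  set u := vvec c E0 {i} with hu
  have hcc : 0 < 1 / (1 - c) := one_div_pos.2 (by linarith)
  have hui : u i = 1 / (1 - c) := by
    have h1 := hs i
    have hf : Finset.univ.filter (fun j => (i, j) ∈ E0) = {i} := by
      ext j
      simp [hii]
    have hd : outdeg E0 i = 1 := by
      rw [outdeg, hf, Finset.card_singleton]
    rw [aux_row, hf, hd] at h1
    simp [ind] at h1
    rw [eq_div_iff (by linarith)]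
    linarith
  have ha : (Pmat E *ᵥ u) i ≤ 1 / (1 - c) := by
    calc (Pmat E *ᵥ u) i = ∑ j, Pmat E i j * u j := rfl
      _ ≤ ∑ j, Pmat E i j * (1 / (1 - c)) := Finset.sum_le_sum fun j _ =>
          mul_le_mul_of_nonneg_left (hb j).2 (aux_nonneg E i j)
      _ = _ := by rw [← Finset.sum_mul, aux_sum E h, one_mul]
  have hpos : 0 < 1 / (1 - c) - c * (Pmat E *ᵥ u) i := by nlinarith
  refine ⟨hpos, hui, ?_⟩
  set s := 1 / (1 - c) - c * (Pmat E *ᵥ u) i with hsd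
  have hv : s⁻¹ • u = vvec c E {i} := by
    rw [aux_solve E h c hc0 hc1]
    intro k
    rw [Matrix.mulVec_smul]
    simp only [Pi.smul_apply, smul_eq_mul]
    by_cases hk : k = i
    · subst hk
      rw [hui]
      simp only [ind, Finset.mem_singleton, if_true]
      field_simp
      rw [hsd]
      field_simp
      ring
    · have hrow : (Pmat E *ᵥ u) k = (Pmat E0 *ᵥ u) k := by
        rw [aux_row, aux_row, outdeg, outdeg]
        simp only [hsame k hk]
      have := hs k
      rw [hrow]
      simp only [ind, Finset.mem_singleton, hk, if_false, zero_add] at this ⊢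
      rw [this]
      ring
  rw [aux_pr, ← hv, mul_div_assoc, Finset.sum_div]
  congr 1
  refine Finset.sum_congr rfl fun j _ => ?_
  simp only [Pi.smul_apply, smul_eq_mul]
  ring

/-- Corollary 17 (Optimal link structure for a single node with no self-link): for
`I = {i}` with empty internal link set, an admissible outlink set `F ⊆ {i} × Ī`
maximizes the PageRank `π_i` if and only if `F` is nonempty and `F ⊆ {(i,j) : j ∈ V₀}`,
where `V₀` is the argmax of `v₀` over `Ī` in the basic absorbing graph
`E⁰ = {(i,i)} ∪ E_in(I) ∪ E_Ī`. -/
theorem stmt18 {n : ℕ} (hn : 1 ≤ n) (c : ℝ) (hc0 : 0 < c) (hc1 : c < 1)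
    (z : Fin n → ℝ) (hz : ∀ i, 0 < z i) (hz1 : ∑ i, z i = 1)
    (i : Fin n) (hIc : (({i} : Finset (Fin n))ᶜ).Nonempty)
    (Ein Eext : Finset (Fin n × Fin n))
    (hEin : ∀ p ∈ Ein, p.1 ≠ i ∧ p.2 = i)
    (hEext : ∀ p ∈ Eext, p.1 ≠ i ∧ p.2 ≠ i)
    (hout : ∀ j, j ≠ i → ∃ k, (j, k) ∈ Ein ∪ Eext)
    (F : Finset (Fin n × Fin n)) (hF : ∀ p ∈ F, p.1 = i ∧ p.2 ≠ i)
    (hAdm : admissible (F ∪ Ein ∪ Eext) {i}) :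
    (∀ F' : Finset (Fin n × Fin n), (∀ p ∈ F', p.1 = i ∧ p.2 ≠ i) →
      admissible (F' ∪ Ein ∪ Eext) {i} →
      prSet c z (F' ∪ Ein ∪ Eext) {i} ≤ prSet c z (F ∪ Ein ∪ Eext) {i}) ↔
    (F.Nonempty ∧ ∀ p ∈ F, ∀ k, k ≠ i →
      vvec c ({(i, i)} ∪ Ein ∪ Eext) {i} k ≤
        vvec c ({(i, i)} ∪ Ein ∪ Eext) {i} p.2) := by
  set E0 : Finset (Fin n × Fin n) := {(i, i)} ∪ Ein ∪ Eext with hE0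
  set u := vvec c E0 {i} with hu
  have hii : ∀ j, (i, j) ∈ E0 ↔ j = i := by
    intro j
    simp only [hE0, Finset.mem_union, Finset.mem_singleton, Prod.mk.injEq, true_and]
    constructor
    · rintro ((h | h) | h)
      · exact h
      · exact absurd rfl (hEin _ h).1
      · exact absurd rfl (hEext _ h).1
    · intro h
      exact Or.inl (Or.inl h)
  have h0 : ∀ k, 0 < outdeg E0 k := by
    intro k
    rw [outdeg, Finset.card_pos]
    by_cases hk : k = i
    · exact ⟨i, by simp [hk, hii]⟩
    · obtain ⟨l, hl⟩ := hout k hk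
      refine ⟨l, ?_⟩
      simp only [hE0, Finset.mem_filter, Finset.mem_univ, true_and, Finset.mem_union] at hl ⊢
      tauto
  have hsame : ∀ G : Finset (Fin n × Fin n), (∀ p ∈ G, p.1 = i ∧ p.2 ≠ i) →
      ∀ k, k ≠ i → ∀ j, (k, j) ∈ G ∪ Ein ∪ Eext ↔ (k, j) ∈ E0 := by
    intro G hG k hk j
    have h1 : (k, j) ∉ G := fun h => hk (hG _ h).1
    simp [hE0, h1, hk]
  have hrowi : ∀ G : Finset (Fin n × Fin n), ∀ j, (i, j) ∈ G ∪ Ein ∪ Eext ↔ (i, j) ∈ G := by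
    intro G j
    have h1 : (i, j) ∉ Ein := fun h => (hEin _ h).1 rfl
    have h2 : (i, j) ∉ Eext := fun h => (hEext _ h).1 rfl
    simp [h1, h2]
  -- the average of `u` over the outlinks
  have hav : ∀ G : Finset (Fin n × Fin n), 0 < outdeg (G ∪ Ein ∪ Eext) i →
      ∑ j ∈ Finset.univ.filter (fun j => (i, j) ∈ G),
        ((Pmat (G ∪ Ein ∪ Eext) *ᵥ u) i - u j) = 0 := by
    intro G hG
    rw [aux_row]
    unfold outdeg at hG ⊢
    simp only [hrowi] at hG ⊢
    rw [Finset.sum_sub_distrib, Finset.sum_const, nsmul_eq_mul, ← mul_assoc,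
      mul_inv_cancel₀ (by positivity), one_mul, sub_self]
  have hzu : 0 < ∑ j, z j * u j := by
    have hb := aux_bounds E0 h0 c hc0 hc1 {i}
    obtain ⟨-, hui, -⟩ := aux_formula c hc0 hc1 z i _ E0 hAdm.1 h0 hii (hsame F hF)
    refine Finset.sum_pos' (fun j _ => mul_nonneg (hz j).le (hb j).1) ⟨i, Finset.mem_univ i, ?_⟩
    rw [hu, hui]
    exact mul_pos (hz i) (one_div_pos.2 (by linarith))
  have hcmp : ∀ G : Finset (Fin n × Fin n), (∀ p ∈ G, p.1 = i ∧ p.2 ≠ i) →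
      admissible (G ∪ Ein ∪ Eext) {i} →
      (prSet c z (G ∪ Ein ∪ Eext) {i} ≤ prSet c z (F ∪ Ein ∪ Eext) {i} ↔
        (Pmat (G ∪ Ein ∪ Eext) *ᵥ u) i ≤ (Pmat (F ∪ Ein ∪ Eext) *ᵥ u) i) := by
    intro G hG hA
    obtain ⟨p1, -, e1⟩ := aux_formula c hc0 hc1 z i _ E0 hAdm.1 h0 hii (hsame F hF)
    obtain ⟨p2, -, e2⟩ := aux_formula c hc0 hc1 z i _ E0 hA.1 h0 hii (hsame G hG)
    rw [e1, e2, div_le_div_iff_of_pos_left (mul_pos (by linarith) hzu) p2 p1,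
      sub_le_sub_iff_left, mul_le_mul_iff_right₀ hc0]
  have hne : ∀ G : Finset (Fin n × Fin n), 0 < outdeg (G ∪ Ein ∪ Eext) i →
      (Finset.univ.filter (fun j => (i, j) ∈ G)).Nonempty := by
    intro G hG
    unfold outdeg at hG
    simp only [hrowi] at hG
    exact Finset.card_pos.1 hG
  constructor
  · intro hmax
    have hub : ∀ k, k ≠ i → u k ≤ (Pmat (F ∪ Ein ∪ Eext) *ᵥ u) i := by
      intro k hk
      have hG : ∀ p ∈ ({(i, k)} : Finset (Fin n × Fin n)), p.1 = i ∧ p.2 ≠ i := by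
        intro p hp
        rw [Finset.mem_singleton] at hp
        subst hp
        exact ⟨rfl, hk⟩
      have hA : admissible ({(i, k)} ∪ Ein ∪ Eext) {i} := by
        constructor
        · intro l
          rw [outdeg, Finset.card_pos]
          by_cases hl : l = i
          · exact ⟨k, by simp [hl]⟩
          · obtain ⟨m, hm⟩ := hout l hl
            refine ⟨m, ?_⟩
            simp only [Finset.mem_filter, Finset.mem_univ, true_and, Finset.mem_union] at hm ⊢
            tauto
        · intro l hl
          rw [Finset.mem_singleton] at hl
          subst hl
          exact ⟨k, by simpa using hk, Relation.ReflTransGen.single (by simp)⟩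
      have h1 := (hcmp _ hG hA).1 (hmax _ hG hA)
      have h2 := hav _ (hA.1 i)
      have hf : Finset.univ.filter (fun j => (i, j) ∈ ({(i, k)} : Finset (Fin n × Fin n)))
          = {k} := by
        ext j
        simp
      rw [hf, Finset.sum_singleton] at h2
      linarith
    constructor
    · obtain ⟨j, hj⟩ := hne F (hAdm.1 i)
      exact ⟨(i, j), (Finset.mem_filter.1 hj).2⟩
    · rintro ⟨a, b⟩ hp k hk
      obtain ⟨ha, hb⟩ := hF _ hp
      simp only at ha hb
      subst ha
      have h2 := hav F (hAdm.1 a)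
      rw [Finset.sum_eq_zero_iff_of_nonneg] at h2
      · have h3 := h2 b (by simpa using hp)
        have h4 := hub k hk
        show u k ≤ u b
        linarith
      · intro j hj
        have := hub j (hF _ (Finset.mem_filter.1 hj).2).2
        linarith
  · rintro ⟨-, hopt⟩ G hG hA
    rw [hcmp G hG hA]
    by_contra hlt
    rw [not_le] at hlt
    -- some outlink of `G` is at least its average, some outlink of `F` is at most its average
    obtain ⟨j, hj, hj'⟩ := Finset.exists_le_of_sum_le (hne G (hA.1 i))
      (f := fun j => (Pmat (G ∪ Ein ∪ Eext) *ᵥ u) i - u j) (g := fun _ => 0)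
      (by rw [hav G (hA.1 i)]; simp)
    obtain ⟨l, hl, hl'⟩ := Finset.exists_le_of_sum_le (hne F (hAdm.1 i))
      (g := fun j => (Pmat (F ∪ Ein ∪ Eext) *ᵥ u) i - u j) (f := fun _ => 0)
      (by rw [hav F (hAdm.1 i)]; simp)
    have h5 := hopt _ (Finset.mem_filter.1 hl).2 j (hG _ (Finset.mem_filter.1 hj).2).2
    simp only at h5 hj' hl'
    linarith
end
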